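/- arXiv:2201.01766 — 2 statements merged into one kernel-verified Lean document; each statement's English description precedes it below -/
import Mathlib

section
/- There exists a universal constant N such that for every classical solution (u,Π) of the 3D Navier–Stokes equations on Q(1), every z₀=(x₀,t₀)∈Q(1/8), and all radii with 0<2ρ≤R≤1/4, one has D(z₀,ρ) ≤ N·(ρ/R)·D(z₀,R) + N·(R/ρ)²·C(z₀,R). -/
open Real MeasureTheory Set
open scoped ENNReal
noncomputable section

abbrev E3 := EuclideanSpace ℝ (Fin 3)

/-- `i`-th standard basis vector of `ℝ³`. -/
def ee (i : Fin 3) : E3 := EuclideanSpace.single i 1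

/-- partial derivative of a scalar function in the direction `eᵢ`. -/
def pd (f : E3 → ℝ) (i : Fin 3) (x : E3) : ℝ := fderiv ℝ f x (ee i)

/-- Laplacian of a scalar function. -/
def lap (f : E3 → ℝ) (x : E3) : ℝ := ∑ i, pd (fun y => pd f i y) i x

/-- parabolic cylinder `Q(z₀,R) = B(x₀,R) × (t₀ - R², t₀)`. -/
def Qyl (z₀ : E3 × ℝ) (R : ℝ) : Set (E3 × ℝ) :=
  (Metric.ball z₀.1 R) ×ˢ (Ioo (z₀.2 - R ^ 2) z₀.2)

/-- `(u, P)` is a classical solution of the 3D Navier–Stokes equations on the open set `U`,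
which contains the closure of `Q(1)`. -/
structure IsNSQ1 (u : E3 → ℝ → E3) (P : E3 → ℝ → ℝ) (U : Set (E3 × ℝ)) : Prop where
  open_U : IsOpen U
  subset_U : closure (Qyl (0, 0) 1) ⊆ U
  smooth_u : ContDiffOn ℝ (⊤ : ℕ∞) (fun z : E3 × ℝ => u z.1 z.2) U
  smooth_P : ContDiffOn ℝ (⊤ : ℕ∞) (fun z : E3 × ℝ => P z.1 z.2) U
  momentum : ∀ x : E3, ∀ t : ℝ, (x, t) ∈ U → ∀ j : Fin 3,
    deriv (fun s => u x s j) t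
      + (∑ i, u x t i * pd (fun y => u y t j) i x)
      - lap (fun y => u y t j) x
      + pd (fun y => P y t) j x = 0
  divfree : ∀ x : E3, ∀ t : ℝ, (x, t) ∈ U → ∑ i, pd (fun y => u y t i) i x = 0

/-- `(u, P)` is axially symmetric on `U`: in cylindrical coordinates
`u = uʳ eᵣ + uᶿ e_θ + u³ e₃` and `P = p(r, x₃, t)`. -/
def IsAxisym (u : E3 → ℝ → E3) (P : E3 → ℝ → ℝ) (U : Set (E3 × ℝ)) : Prop :=
  ∃ ur uθ u3 pp : ℝ → ℝ → ℝ → ℝ,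
    ∀ x : E3, ∀ t : ℝ, (x, t) ∈ U → x 0 ^ 2 + x 1 ^ 2 ≠ 0 →
      u x t 0 = ur (Real.sqrt (x 0 ^ 2 + x 1 ^ 2)) (x 2) t
                  * (x 0 / Real.sqrt (x 0 ^ 2 + x 1 ^ 2))
                - uθ (Real.sqrt (x 0 ^ 2 + x 1 ^ 2)) (x 2) t
                  * (x 1 / Real.sqrt (x 0 ^ 2 + x 1 ^ 2)) ∧
      u x t 1 = ur (Real.sqrt (x 0 ^ 2 + x 1 ^ 2)) (x 2) t
                  * (x 1 / Real.sqrt (x 0 ^ 2 + x 1 ^ 2))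
                + uθ (Real.sqrt (x 0 ^ 2 + x 1 ^ 2)) (x 2) t
                  * (x 0 / Real.sqrt (x 0 ^ 2 + x 1 ^ 2)) ∧
      u x t 2 = u3 (Real.sqrt (x 0 ^ 2 + x 1 ^ 2)) (x 2) t ∧
      P x t = pp (Real.sqrt (x 0 ^ 2 + x 1 ^ 2)) (x 2) t

/-- `Γ = r uᶿ = x₁ u₂ - x₂ u₁`. -/
def Gam (u : E3 → ℝ → E3) (x : E3) (t : ℝ) : ℝ := x 0 * u x t 1 - x 1 * u x t 0

/-- Cartesian components of `b = uʳ eᵣ + u³ e₃ = u - uᶿ e_θ`. -/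
def bcomp (u : E3 → ℝ → E3) (x : E3) (t : ℝ) : Fin 3 → ℝ :=
  ![u x t 0 + x 1 * Gam u x t / (x 0 ^ 2 + x 1 ^ 2),
    u x t 1 - x 0 * Gam u x t / (x 0 ^ 2 + x 1 ^ 2),
    u x t 2]

/-- Euclidean norm of `b`. -/
def bnorm (u : E3 → ℝ → E3) (x : E3) (t : ℝ) : ℝ :=
  Real.sqrt (∑ i, (bcomp u x t i) ^ 2)

/-- `A(z₀,R)`. -/
def AA (u : E3 → ℝ → E3) (z₀ : E3 × ℝ) (R : ℝ) : ℝ :=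
  ⨆ t ∈ Ioo (z₀.2 - R ^ 2) z₀.2, R⁻¹ * ∫ x in Metric.ball z₀.1 R, ‖u x t‖ ^ 2

/-- `E(z₀,R)`. -/
def EE (u : E3 → ℝ → E3) (z₀ : E3 × ℝ) (R : ℝ) : ℝ :=
  R⁻¹ * ∫ t in Ioo (z₀.2 - R ^ 2) z₀.2, ∫ x in Metric.ball z₀.1 R,
    ∑ j, ∑ i, (pd (fun y => u y t j) i x) ^ 2

/-- `C(z₀,R)`. -/
def CC (u : E3 → ℝ → E3) (z₀ : E3 × ℝ) (R : ℝ) : ℝ :=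
  (R ^ 2)⁻¹ * ∫ t in Ioo (z₀.2 - R ^ 2) z₀.2, ∫ x in Metric.ball z₀.1 R, ‖u x t‖ ^ 3

/-- `D(z₀,R)`. -/
def DD (P : E3 → ℝ → ℝ) (z₀ : E3 × ℝ) (R : ℝ) : ℝ :=
  (R ^ 2)⁻¹ * ∫ t in Ioo (z₀.2 - R ^ 2) z₀.2, ∫ x in Metric.ball z₀.1 R, |P x t| ^ (3/2 : ℝ)

/-- `𝓔(z₀,R) = A + E + D`. -/
def EEE (u : E3 → ℝ → E3) (P : E3 → ℝ → ℝ) (z₀ : E3 × ℝ) (R : ℝ) : ℝ :=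
  AA u z₀ R + EE u z₀ R + DD P z₀ R

/-- the weight `ω(R) = (ln ln (100/R))⁻¹`. -/
def omg (R : ℝ) : ℝ := (Real.log (Real.log (100 / R)))⁻¹

/-- `G(z₀,R) = R^{1-3/p-2/q} ‖b‖_{L^{p,q}(Q(z₀,R))}` (space norm `Lᵖ`, time norm `L^q`). -/
def Gfun (u : E3 → ℝ → E3) (p q : ℝ≥0∞) (z₀ : E3 × ℝ) (R : ℝ) : ℝ :=
  R ^ (1 - 3 / p.toReal - 2 / q.toReal) *
    (eLpNorm (fun t =>
        (eLpNorm (fun x => bnorm u x t) p (volume.restrict (Metric.ball z₀.1 R))).toReal)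
      q (volume.restrict (Ioo (z₀.2 - R ^ 2) z₀.2))).toReal

/-- `m_R = inf_{Q(R)} Γ`. -/
def mR (u : E3 → ℝ → E3) (R : ℝ) : ℝ :=
  sInf ((fun z : E3 × ℝ => Gam u z.1 z.2) '' Qyl (0, 0) R)

/-- `M_R = sup_{Q(R)} Γ`. -/
def MMR (u : E3 → ℝ → E3) (R : ℝ) : ℝ :=
  sSup ((fun z : E3 × ℝ => Gam u z.1 z.2) '' Qyl (0, 0) R)

/-- `J_R = M_R - m_R`. -/
def JR (u : E3 → ℝ → E3) (R : ℝ) : ℝ := MMR u R - mR u R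

/-- the normalized function `h`. -/
def hfun (u : E3 → ℝ → E3) (R : ℝ) (x : E3) (t : ℝ) : ℝ :=
  if -(mR u R) < MMR u R then 2 * (MMR u R - Gam u x t) / JR u R
  else 2 * (Gam u x t - mR u R) / JR u R

/-- oscillation of `Γ` over `Q(z₀,R)`. -/
def oscΓ (u : E3 → ℝ → E3) (z₀ : E3 × ℝ) (R : ℝ) : ℝ :=
  sSup ((fun z : E3 × ℝ => Gam u z.1 z.2) '' Qyl z₀ R) -
    sInf ((fun z : E3 × ℝ => Gam u z.1 z.2) '' Qyl z₀ R)

/-! ### Bounded, decaying and test functions -/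

/-- An integrable polynomial weight on `ℝ³`. -/
def wt (x : E3) : ℝ := ((1 + ‖x‖) ^ 4)⁻¹

lemma wt_pos (x : E3) : 0 < wt x := by unfold wt; positivity

lemma wt_le_one (x : E3) : wt x ≤ 1 := by
  unfold wt
  exact inv_le_one_of_one_le₀ (one_le_pow₀ (by linarith [norm_nonneg x]))

lemma integrable_wt : Integrable wt := by
  have h := integrable_one_add_norm (E := E3) (μ := volume) (r := 4) (by simp; norm_num)
  refine h.congr (Filter.Eventually.of_forall fun x => ?_)
  have : (0 : ℝ) ≤ 1 + ‖x‖ := by positivity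
  simp only [wt]
  rw [Real.rpow_neg this]
  norm_cast

/-- Bounded continuous functions. -/
def BC (f : E3 → ℝ) : Prop := Continuous f ∧ ∃ C, ∀ x, |f x| ≤ C

/-- Continuous functions dominated by the weight `wt`. -/
def Dk (f : E3 → ℝ) : Prop := Continuous f ∧ ∃ C, 0 ≤ C ∧ ∀ x, |f x| ≤ C * wt x

lemma Dk.bc {f : E3 → ℝ} (h : Dk f) : BC f := by
  obtain ⟨hc, C, hC, h⟩ := h
  exact ⟨hc, C, fun x => (h x).trans (mul_le_of_le_one_right hC (wt_le_one x))⟩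

lemma Dk.integrable {f : E3 → ℝ} (h : Dk f) : Integrable f := by
  obtain ⟨hc, C, hC, h⟩ := h
  exact (integrable_wt.const_mul C).mono' hc.aestronglyMeasurable (Filter.Eventually.of_forall h)

lemma BC.mul_dk {f g : E3 → ℝ} (hf : BC f) (hg : Dk g) : Dk (fun x => f x * g x) := by
  obtain ⟨hc, C, h⟩ := hf
  obtain ⟨hc', C', hC', h'⟩ := hg
  have hC : 0 ≤ C := (abs_nonneg _).trans (h 0)
  refine ⟨hc.mul hc', C * C', by positivity, fun x => ?_⟩
  rw [abs_mul, mul_assoc]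
  exact mul_le_mul (h x) (h' x) (abs_nonneg _) hC

lemma Dk.mul_bc {f g : E3 → ℝ} (hf : Dk f) (hg : BC g) : Dk (fun x => f x * g x) := by
  simpa only [mul_comm] using hg.mul_dk hf

lemma Dk.add {f g : E3 → ℝ} (hf : Dk f) (hg : Dk g) : Dk (fun x => f x + g x) := by
  obtain ⟨hc, C, hC, h⟩ := hf
  obtain ⟨hc', C', hC', h'⟩ := hg
  refine ⟨hc.add hc', C + C', by positivity, fun x => ?_⟩
  rw [add_mul]
  exact (abs_add_le _ _).trans (add_le_add (h x) (h' x))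

lemma BC.const (c : ℝ) : BC (fun _ => c) := ⟨continuous_const, |c|, fun _ => le_rfl⟩

lemma BC.mul {f g : E3 → ℝ} (hf : BC f) (hg : BC g) : BC (fun x => f x * g x) := by
  obtain ⟨hc, C, h⟩ := hf
  obtain ⟨hc', C', h'⟩ := hg
  have hC : 0 ≤ C := (abs_nonneg _).trans (h 0)
  refine ⟨hc.mul hc', C * C', fun x => ?_⟩
  rw [abs_mul]
  exact mul_le_mul (h x) (h' x) (abs_nonneg _) hC

lemma BC.add {f g : E3 → ℝ} (hf : BC f) (hg : BC g) : BC (fun x => f x + g x) := by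
  obtain ⟨hc, C, h⟩ := hf
  obtain ⟨hc', C', h'⟩ := hg
  exact ⟨hc.add hc', C + C', fun x => (abs_add_le _ _).trans (add_le_add (h x) (h' x))⟩

lemma Dk.const_mul {f : E3 → ℝ} (c : ℝ) (hf : Dk f) : Dk (fun x => c * f x) :=
  (BC.const c).mul_dk hf

lemma Dk.sum {ι : Type*} (s : Finset ι) {f : ι → E3 → ℝ} (hf : ∀ i ∈ s, Dk (f i)) :
    Dk (fun x => ∑ i ∈ s, f i x) := by
  classical
  induction s using Finset.induction_on with
  | empty => exact ⟨by simpa using continuous_const, 0, le_rfl, fun x => by simp⟩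
  | insert a s ha ih =>
    simp only [Finset.sum_insert ha]
    exact (hf a (Finset.mem_insert_self a s)).add
      (ih fun i hi => hf i (Finset.mem_insert_of_mem hi))

/-- Smooth compactly supported functions. -/
def TF (f : E3 → ℝ) : Prop := ContDiff ℝ (⊤ : ℕ∞) f ∧ HasCompactSupport f

lemma contDiff_pd {f : E3 → ℝ} (hf : ContDiff ℝ (⊤ : ℕ∞) f) (i : Fin 3) :
    ContDiff ℝ (⊤ : ℕ∞) (pd f i) :=
  (hf.fderiv_right (by simp)).clm_apply contDiff_const

lemma TF.pd {f : E3 → ℝ} (hf : TF f) (i : Fin 3) : TF (pd f i) :=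
  ⟨contDiff_pd hf.1 i, hf.2.fderiv_apply ℝ (ee i)⟩

lemma TF.mul {f g : E3 → ℝ} (hf : TF f) (hg : ContDiff ℝ (⊤ : ℕ∞) g) : TF (fun x => f x * g x) :=
  ⟨hf.1.mul hg, hf.2.mul_right⟩

lemma TF.add {f g : E3 → ℝ} (hf : TF f) (hg : TF g) : TF (fun x => f x + g x) :=
  ⟨hf.1.add hg.1, hf.2.add hg.2⟩

lemma TF.sum {ι : Type*} (s : Finset ι) {f : ι → E3 → ℝ} (hf : ∀ i ∈ s, TF (f i)) :
    TF (fun x => ∑ i ∈ s, f i x) := by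
  classical
  induction s using Finset.induction_on with
  | empty => exact ⟨by simpa using contDiff_const, by
      simp only [Finset.sum_empty]
      exact HasCompactSupport.zero⟩
  | insert a s ha ih =>
    simp only [Finset.sum_insert ha]
    exact (hf a (Finset.mem_insert_self a s)).add
      (ih fun i hi => hf i (Finset.mem_insert_of_mem hi))

lemma dk_of_hasCompactSupport {f : E3 → ℝ} (hc : Continuous f) (hs : HasCompactSupport f) :
    Dk f := by
  have hcont : Continuous (fun x : E3 => (1 + ‖x‖) ^ 4) := by fun_prop
  obtain ⟨C, hC⟩ := (hs.mul_right (f' := fun x : E3 => (1 + ‖x‖) ^ 4)).exists_bound_of_continuous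
    (hc.mul hcont)
  refine ⟨hc, C, (norm_nonneg _).trans (hC 0), fun x => ?_⟩
  have h := hC x
  have hp : (0 : ℝ) < (1 + ‖x‖) ^ 4 := by positivity
  rw [wt, ← div_eq_mul_inv, le_div_iff₀ hp]
  simpa only [Pi.mul_apply, Real.norm_eq_abs, abs_mul, abs_of_pos hp] using h

lemma TF.dk {f : E3 → ℝ} (hf : TF f) : Dk f := dk_of_hasCompactSupport hf.1.continuous hf.2

lemma TF.differentiable {f : E3 → ℝ} (hf : TF f) : Differentiable ℝ f :=
  hf.1.differentiable (by simp)

/-- Integration by parts, one factor bounded and the other one decaying. -/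
lemma integral_mul_pd {f g : E3 → ℝ} (i : Fin 3) (hf : Differentiable ℝ f)
    (hg : Differentiable ℝ g) (hfb : BC f) (hfb' : BC (pd f i)) (hgd : Dk g) (hgd' : Dk (pd g i)) :
    ∫ x, f x * pd g i x = - ∫ x, pd f i x * g x :=
  integral_mul_fderiv_eq_neg_fderiv_mul_of_integrable (hfb'.mul_dk hgd).integrable
    (hfb.mul_dk hgd').integrable (hfb.mul_dk hgd).integrable (fun x _ => hf x) (fun x _ => hg x)

lemma pd_mul {f g : E3 → ℝ} {x : E3} (hf : DifferentiableAt ℝ f x) (hg : DifferentiableAt ℝ g x)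
    (i : Fin 3) : pd (fun y => f y * g y) i x = f x * pd g i x + pd f i x * g x := by
  unfold pd
  rw [fderiv_fun_mul hf hg]
  simp [mul_comm]

lemma pd_add {f g : E3 → ℝ} {x : E3} (hf : DifferentiableAt ℝ f x) (hg : DifferentiableAt ℝ g x)
    (i : Fin 3) : pd (fun y => f y + g y) i x = pd f i x + pd g i x := by
  unfold pd
  rw [fderiv_fun_add hf hg]
  simp

lemma pd_comp {φ : ℝ → ℝ} {φ' : ℝ} {f : E3 → ℝ} {x : E3} (hφ : HasDerivAt φ φ' (f x))
    (hf : DifferentiableAt ℝ f x) (i : Fin 3) : pd (fun y => φ (f y)) i x = φ' * pd f i x := by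
  unfold pd
  have h : HasFDerivAt (fun y => φ (f y)) (φ' • fderiv ℝ f x) x :=
    hφ.comp_hasFDerivAt x hf.hasFDerivAt
  rw [h.fderiv]
  simp

lemma fderiv_eq_sum_pd (f : E3 → ℝ) (x z : E3) : fderiv ℝ f x z = ∑ i, z i * pd f i x := by
  have hz : z = ∑ i, z i • ee i := by
    ext j
    simp [ee, Fin.sum_univ_three]
    fin_cases j <;> simp
  conv_lhs => rw [hz]
  simp [map_sum, pd]

/-! ### The Gaussian -/

/-- Normalisation constant of the standard Gaussian on `ℝ³`. -/
def gamZ : ℝ := ∫ x : E3, exp (-(1 / 2) * ‖x‖ ^ 2)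

/-- Standard Gaussian density on `ℝ³`. -/
def gam (x : E3) : ℝ := gamZ⁻¹ * exp (-(1 / 2) * ‖x‖ ^ 2)

lemma gamZ_pos : 0 < gamZ := by
  rw [gamZ, GaussianFourier.integral_rexp_neg_mul_sq_norm (by norm_num)]
  positivity

lemma gam_pos (x : E3) : 0 < gam x := mul_pos (inv_pos.2 gamZ_pos) (exp_pos _)

lemma integral_gam : ∫ x, gam x = 1 := by
  simp only [gam]
  rw [integral_const_mul]
  exact inv_mul_cancel₀ gamZ_pos.ne'

lemma contDiff_gam : ContDiff ℝ (⊤ : ℕ∞) gam := by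
  unfold gam
  exact contDiff_const.mul ((contDiff_const.mul (contDiff_norm_sq ℝ)).exp)

lemma pd_gam (i : Fin 3) (x : E3) : pd gam i x = -(x i) * gam x := by
  have h : HasFDerivAt (fun y : E3 => ‖y‖ ^ 2) (2 • innerSL ℝ x) x :=
    (hasStrictFDerivAt_norm_sq x).hasFDerivAt
  have h2 := ((h.const_mul (-(1 / 2) : ℝ)).exp).const_mul gamZ⁻¹
  unfold pd gam
  rw [h2.fderiv]
  simp [ee, EuclideanSpace.inner_single_right]
  ring

lemma gam_bound : ∃ K, 0 < K ∧ ∀ x, gam x * (1 + 2 * ‖x‖) ^ 8 ≤ K := by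
  refine ⟨gamZ⁻¹ * (16 ^ 4 * 256), mul_pos (inv_pos.2 gamZ_pos) (by norm_num), fun x => ?_⟩
  rw [gam, mul_assoc]
  refine mul_le_mul_of_nonneg_left ?_ (inv_pos.2 gamZ_pos).le
  set t := ‖x‖
  set q := 1 / 2 * t ^ 2 with hq
  have ht : 0 ≤ t := norm_nonneg x
  have hq0 : 0 ≤ q := by positivity
  have h1 : (1 + 2 * t) ^ 2 ≤ 16 * (1 + q) := by nlinarith [sq_nonneg (t - 1)]
  have h2 : 1 + q ≤ 4 * exp (q / 4) := by linarith [add_one_le_exp (q / 4)]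
  have h3 : (1 + 2 * t) ^ 8 ≤ (16 * (4 * exp (q / 4))) ^ 4 := by
    calc (1 + 2 * t) ^ 8 = ((1 + 2 * t) ^ 2) ^ 4 := by ring
      _ ≤ _ := pow_le_pow_left₀ (by positivity) (h1.trans (by linarith)) 4
  have h4 : (16 * (4 * exp (q / 4))) ^ 4 = 16 ^ 4 * 256 * exp q := by
    have h5 : exp (q / 4) ^ 4 = exp q := by
      rw [← exp_nat_mul]
      congr 1
      push_cast
      ring
    rw [mul_pow, mul_pow, h5]
    norm_num
    ring
  have h5 : -(1 / 2) * t ^ 2 = -q := by rw [hq]; ring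
  rw [h5, exp_neg]
  calc (exp q)⁻¹ * (1 + 2 * t) ^ 8 ≤ (exp q)⁻¹ * (16 ^ 4 * 256 * exp q) := by
        gcongr; exact h3.trans h4.le
    _ = 16 ^ 4 * 256 := by field_simp

lemma dk_gam_pow : Dk (fun x => gam x * (1 + 2 * ‖x‖) ^ 4) := by
  obtain ⟨K, hK, h⟩ := gam_bound
  refine ⟨contDiff_gam.continuous.mul (by fun_prop), K, hK.le, fun x => ?_⟩
  have hp : (0 : ℝ) < (1 + ‖x‖) ^ 4 := by positivity
  rw [abs_of_nonneg (mul_nonneg (gam_pos x).le (by positivity)), wt, ← div_eq_mul_inv,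
    le_div_iff₀ hp]
  refine le_trans ?_ (h x)
  rw [mul_assoc]
  refine mul_le_mul_of_nonneg_left ?_ (gam_pos x).le
  calc (1 + 2 * ‖x‖) ^ 4 * (1 + ‖x‖) ^ 4 ≤ (1 + 2 * ‖x‖) ^ 4 * (1 + 2 * ‖x‖) ^ 4 := by
        gcongr; linarith [norm_nonneg x]
    _ = _ := by ring

lemma dk_of_le_gam {f : E3 → ℝ} (hc : Continuous f)
    (h : ∀ x, |f x| ≤ gam x * (1 + 2 * ‖x‖) ^ 4) : Dk f := by
  obtain ⟨_, K, hK, h'⟩ := dk_gam_pow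
  exact ⟨hc, K, hK, fun x => (h x).trans ((le_abs_self _).trans (h' x))⟩

lemma dk_gam : Dk gam := by
  refine dk_of_le_gam contDiff_gam.continuous fun x => ?_
  rw [abs_of_pos (gam_pos x)]
  exact le_mul_of_one_le_right (gam_pos x).le
    (one_le_pow₀ (by linarith [norm_nonneg x]))

lemma dk_gam_norm : Dk (fun x => gam x * ‖x‖) := by
  refine dk_of_le_gam (contDiff_gam.continuous.mul continuous_norm) fun x => ?_
  rw [abs_of_nonneg (mul_nonneg (gam_pos x).le (norm_nonneg x))]
  refine mul_le_mul_of_nonneg_left ?_ (gam_pos x).le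
  calc ‖x‖ ≤ 1 + 2 * ‖x‖ := by linarith [norm_nonneg x]
    _ ≤ _ := le_self_pow₀ (by linarith [norm_nonneg x]) (by norm_num)

lemma abs_coord_le (x : E3) (i : Fin 3) : |x i| ≤ ‖x‖ := by
  simpa using PiLp.norm_apply_le x i

lemma dk_pd_gam (i : Fin 3) : Dk (pd gam i) := by
  obtain ⟨_, K, hK, h⟩ := dk_gam_norm
  refine ⟨(contDiff_pd contDiff_gam i).continuous, K, hK, fun x => le_trans ?_ (h x)⟩
  rw [pd_gam, abs_mul, abs_neg, abs_mul, mul_comm, abs_norm]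
  exact mul_le_mul_of_nonneg_left (abs_coord_le x i) (abs_nonneg _)

/-! ### The heat semigroup, parametrised by the standard deviation -/

/-- Gaussian average of a vector-valued function at scale `c`. -/
def gaussAvg {F : Type} [NormedAddCommGroup F] [NormedSpace ℝ F] (f : E3 → F) (c : ℝ) (x : E3) :
    F := ∫ z, gam z • f (x - c • z)

section vector

variable {F : Type} [NormedAddCommGroup F] [NormedSpace ℝ F]

lemma integrable_gam_smul {f : E3 → F} (hf : Continuous f) (hs : HasCompactSupport f) (c : ℝ)
    (x : E3) : Integrable (fun z => gam z • f (x - c • z)) := by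
  obtain ⟨C, hC⟩ := hs.exists_bound_of_continuous hf
  refine (dk_gam.integrable.mul_const C).mono'
    (contDiff_gam.continuous.smul (by fun_prop)).aestronglyMeasurable
    (Filter.Eventually.of_forall fun z => ?_)
  rw [norm_smul, Real.norm_of_nonneg (gam_pos z).le]
  exact mul_le_mul_of_nonneg_left (hC _) (gam_pos z).le

lemma hasFDerivAt_gaussAvg {f : E3 → F} (hf : ContDiff ℝ (⊤ : ℕ∞) f) (hs : HasCompactSupport f)
    (c : ℝ) (x : E3) :
    HasFDerivAt (gaussAvg f c) (gaussAvg (fderiv ℝ f) c x) x := by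
  have hf' : Continuous (fderiv ℝ f) := (hf.fderiv_right (m := (⊤ : ℕ∞)) (by simp)).continuous
  obtain ⟨C, hC⟩ := (hs.fderiv ℝ).exists_bound_of_continuous hf'
  refine hasFDerivAt_integral_of_dominated_of_fderiv_le (bound := fun z => gam z * C)
    (F' := fun x z => gam z • fderiv ℝ f (x - c • z)) Filter.univ_mem
    (Filter.Eventually.of_forall fun y => (integrable_gam_smul hf.continuous hs c y).1)
    (integrable_gam_smul hf.continuous hs c x)
    (integrable_gam_smul hf' (hs.fderiv ℝ) c x).1
    (Filter.Eventually.of_forall fun z y _ => ?_) (dk_gam.integrable.mul_const C)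
    (Filter.Eventually.of_forall fun z y _ => ?_)
  · rw [norm_smul, Real.norm_of_nonneg (gam_pos z).le]
    exact mul_le_mul_of_nonneg_left (hC _) (gam_pos z).le
  · have h := (hf.differentiable (by simp) (y - c • z)).hasFDerivAt
    exact (h.comp y ((hasFDerivAt_id y).sub_const (c • z))).const_smul (gam z)

end vector

lemma contDiff_gaussAvg_nat (n : ℕ) : ∀ {F : Type} [NormedAddCommGroup F] [NormedSpace ℝ F]
    {f : E3 → F}, ContDiff ℝ (⊤ : ℕ∞) f → HasCompactSupport f → ∀ c : ℝ,
    ContDiff ℝ n (gaussAvg f c) := by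
  induction n with
  | zero =>
    intro F _ _ f hf hs c
    refine contDiff_zero.2 ?_
    exact continuous_iff_continuousAt.2 fun x => (hasFDerivAt_gaussAvg hf hs c x).continuousAt
  | succ n ih =>
    intro F _ _ f hf hs c
    exact (contDiff_succ_iff_hasFDerivAt (n := n)).2 ⟨_, ih (hf.fderiv_right (by simp)) (hs.fderiv ℝ) c,
      fun x => hasFDerivAt_gaussAvg hf hs c x⟩

/-- The heat semigroup at time `c ^ 2 / 2`. -/
def heat (f : E3 → ℝ) (c : ℝ) (x : E3) : ℝ := ∫ z, gam z * f (x - c • z)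

lemma contDiff_heat {f : E3 → ℝ} (hf : TF f) (c : ℝ) : ContDiff ℝ (⊤ : ℕ∞) (heat f c) :=
  contDiff_infty.2 fun n => contDiff_gaussAvg_nat n hf.1 hf.2 c

lemma pd_heat {f : E3 → ℝ} (hf : TF f) (c : ℝ) (i : Fin 3) :
    pd (heat f c) i = heat (pd f i) c := by
  funext x
  have h : fderiv ℝ (heat f c) x = gaussAvg (fderiv ℝ f) c x :=
    (hasFDerivAt_gaussAvg hf.1 hf.2 c x).fderiv
  unfold pd
  rw [h]
  unfold gaussAvg heat
  rw [ContinuousLinearMap.integral_apply]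
  · simp
  · exact integrable_gam_smul (hf.1.fderiv_right (m := (⊤ : ℕ∞)) (by simp)).continuous
      (hf.2.fderiv ℝ) c x

lemma heat_zero (f : E3 → ℝ) (x : E3) : heat f 0 x = f x := by
  simp [heat, integral_mul_const, integral_gam]

lemma heat_nonneg {f : E3 → ℝ} (hf : ∀ x, 0 ≤ f x) (c : ℝ) (x : E3) : 0 ≤ heat f c x :=
  integral_nonneg fun z => mul_nonneg (gam_pos z).le (hf _)

lemma TF.integrable_heat {f : E3 → ℝ} (hf : TF f) (c : ℝ) (x : E3) :
    Integrable (fun z => gam z * f (x - c • z)) :=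
  integrable_gam_smul hf.1.continuous hf.2 c x

lemma heat_sum {ι : Type*} (s : Finset ι) {f : ι → E3 → ℝ} (hf : ∀ i ∈ s, TF (f i)) (c : ℝ)
    (x : E3) : heat (fun y => ∑ i ∈ s, f i y) c x = ∑ i ∈ s, heat (f i) c x := by
  unfold heat
  rw [← integral_finsetSum _ fun i hi => (hf i hi).integrable_heat c x]
  simp only [Finset.mul_sum]

lemma heat_decay {f : E3 → ℝ} (hf : TF f) :
    ∃ C, 0 ≤ C ∧ ∀ c, |c| ≤ 2 → ∀ x, |heat f c x| ≤ C * wt x := by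
  obtain ⟨_, C, hC, h⟩ := hf.dk
  have hI := dk_gam_pow.integrable
  refine ⟨C * ∫ z, gam z * (1 + 2 * ‖z‖) ^ 4,
    mul_nonneg hC (integral_nonneg fun z => mul_nonneg (gam_pos z).le (by positivity)),
    fun c hc x => ?_⟩
  unfold heat
  rw [mul_assoc, mul_comm, mul_assoc, ← integral_mul_const, ← Real.norm_eq_abs]
  refine norm_integral_le_of_norm_le (hI.mul_const (wt x * C)) (Filter.Eventually.of_forall fun z => ?_)
  rw [norm_mul, Real.norm_of_nonneg (gam_pos z).le, Real.norm_eq_abs, mul_assoc]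
  refine mul_le_mul_of_nonneg_left ((h _).trans ?_) (gam_pos z).le
  have key : wt (x - c • z) ≤ (1 + 2 * ‖z‖) ^ 4 * wt x := by
    unfold wt
    rw [← div_eq_mul_inv, le_div_iff₀ (by positivity), inv_mul_le_iff₀ (by positivity), ← mul_pow]
    refine pow_le_pow_left₀ (by positivity) ?_ 4
    have h1 : ‖x‖ ≤ ‖x - c • z‖ + ‖c • z‖ := by
      simpa using norm_add_le (x - c • z) (c • z)
    have h2 : ‖c • z‖ ≤ 2 * ‖z‖ := by
      rw [norm_smul]
      exact mul_le_mul_of_nonneg_right hc (norm_nonneg z)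
    nlinarith [norm_nonneg (x - c • z), norm_nonneg z]
  calc C * wt (x - c • z) ≤ C * ((1 + 2 * ‖z‖) ^ 4 * wt x) := mul_le_mul_of_nonneg_left key hC
    _ = _ := by ring

lemma dk_heat {f : E3 → ℝ} (hf : TF f) {c : ℝ} (hc : |c| ≤ 2) : Dk (heat f c) := by
  obtain ⟨C, hC, h⟩ := heat_decay hf
  exact ⟨(contDiff_heat hf c).continuous, C, hC, h c hc⟩

lemma TF.lap {f : E3 → ℝ} (hf : TF f) : TF (lap f) :=
  TF.sum Finset.univ fun i _ => (hf.pd i).pd i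

lemma heat_lap {f : E3 → ℝ} (hf : TF f) (c : ℝ) (x : E3) :
    heat (lap f) c x = ∑ i, heat (pd (pd f i) i) c x :=
  heat_sum Finset.univ (f := fun i => pd (pd f i) i) (fun i _ => (hf.pd i).pd i) c x

lemma BC.comp_affine {f : E3 → ℝ} (hf : BC f) (c : ℝ) (x : E3) : BC (fun z => f (x - c • z)) := by
  obtain ⟨hc, C, h⟩ := hf
  exact ⟨hc.comp (by fun_prop), C, fun z => h _⟩

lemma pd_comp_affine {f : E3 → ℝ} (hf : Differentiable ℝ f) (c : ℝ) (x z : E3) (i : Fin 3) :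
    pd (fun z => f (x - c • z)) i z = -c * pd f i (x - c • z) := by
  have h1 : HasFDerivAt (fun z : E3 => x - c • z) (-(c • ContinuousLinearMap.id ℝ E3)) z :=
    ((hasFDerivAt_id z).const_smul c).const_sub x
  have h := (hf (x - c • z)).hasFDerivAt.comp z h1
  have h' : HasFDerivAt (fun z => f (x - c • z)) _ z := h
  unfold pd
  rw [h'.fderiv]
  simp

lemma integral_pd_gam_mul {f : E3 → ℝ} (hf : TF f) (c : ℝ) (x : E3) (i : Fin 3) :
    ∫ z, f (x - c • z) * pd gam i z = c * heat (pd f i) c x := by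
  have h1 : (fun z => pd (fun z => f (x - c • z)) i z) = fun z => -c * pd f i (x - c • z) :=
    funext fun z => pd_comp_affine hf.differentiable c x z i
  have hd : Differentiable ℝ (fun z => f (x - c • z)) :=
    hf.differentiable.comp (by fun_prop)
  rw [integral_mul_pd i hd (contDiff_gam.differentiable (by simp)) (hf.dk.bc.comp_affine c x)
    (by
      have := (BC.const (-c)).mul ((hf.pd i).dk.bc.comp_affine c x)
      rw [← h1] at this
      exact this) dk_gam (dk_pd_gam i)]
  have h2 : ∀ z, pd (fun z => f (x - c • z)) i z * gam z
      = -c * (gam z * pd f i (x - c • z)) := fun z => by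
    rw [pd_comp_affine hf.differentiable]; ring
  simp only [h2]
  rw [integral_const_mul, heat]
  ring

lemma hasDerivAt_heat {f : E3 → ℝ} (hf : TF f) (c : ℝ) (x : E3) :
    HasDerivAt (fun c => heat f c x) (c * heat (lap f) c x) c := by
  have hf' : Continuous (fderiv ℝ f) := (hf.1.fderiv_right (m := (⊤ : ℕ∞)) (by simp)).continuous
  obtain ⟨C, hC⟩ := (hf.2.fderiv ℝ).exists_bound_of_continuous hf'
  have hder := (hasDerivAt_integral_of_dominated_loc_of_deriv_le (μ := volume)
    (F := fun c z => gam z * f (x - c • z))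
    (F' := fun c z => gam z * (-(fderiv ℝ f (x - c • z) z)))
    (bound := fun z => gam z * ‖z‖ * C) (x₀ := c) Filter.univ_mem
    (Filter.Eventually.of_forall fun c => (hf.integrable_heat c x).1) (hf.integrable_heat c x)
    (Continuous.aestronglyMeasurable (contDiff_gam.continuous.mul
      ((hf'.comp (by fun_prop)).clm_apply continuous_id).neg))
    (Filter.Eventually.of_forall fun z y _ => ?_) (dk_gam_norm.integrable.mul_const C)
    (Filter.Eventually.of_forall fun z y _ => ?_)).2
  · have h1 : ∀ z, gam z * (-(fderiv ℝ f (x - c • z) z))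
        = ∑ i, pd f i (x - c • z) * pd gam i z := fun z => by
      rw [fderiv_eq_sum_pd, ← Finset.sum_neg_distrib, Finset.mul_sum]
      exact Finset.sum_congr rfl fun i _ => by rw [pd_gam]; ring
    have h2 : ∫ z, gam z * (-(fderiv ℝ f (x - c • z) z)) = c * heat (lap f) c x := by
      rw [integral_congr_ae (Filter.Eventually.of_forall h1), integral_finsetSum, heat_lap hf,
        Finset.mul_sum]
      · exact Finset.sum_congr rfl fun i _ => integral_pd_gam_mul (hf.pd i) c x i
      · exact fun i _ => (((hf.pd i).dk.bc.comp_affine c x).mul_dk (dk_pd_gam i)).integrable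
    rw [← h2]
    exact hder
  · rw [norm_mul, Real.norm_of_nonneg (gam_pos z).le, norm_neg, mul_assoc]
    refine mul_le_mul_of_nonneg_left ?_ (gam_pos z).le
    rw [mul_comm]
    exact (ContinuousLinearMap.le_opNorm _ _).trans
      (mul_le_mul_of_nonneg_right (hC _) (norm_nonneg z))
  · have h1 : HasDerivAt (fun c : ℝ => x - c • z) (-z) y := by
      simpa using ((hasDerivAt_id y).smul_const z).const_sub x
    have h2 := ((hf.differentiable (x - y • z)).hasFDerivAt.comp_hasDerivAt y h1).const_mul (gam z)
    simpa using h2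

lemma hasDerivAt_integral_of_le_wt {a a' : ℝ → E3 → ℝ} {C c₀ : ℝ} {s : Set ℝ}
    (hs : s ∈ nhds c₀) (ha : ∀ c x, HasDerivAt (fun c => a c x) (a' c x) c)
    (hcont : ∀ c, Continuous (a c)) (hcont' : Continuous (a' c₀)) (hb : Integrable (a c₀))
    (hb' : ∀ c ∈ s, ∀ x, |a' c x| ≤ C * wt x) :
    HasDerivAt (fun c => ∫ x, a c x) (∫ x, a' c₀ x) c₀ :=
  (hasDerivAt_integral_of_dominated_loc_of_deriv_le (μ := volume) (bound := fun x => C * wt x) hs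
    (Filter.Eventually.of_forall fun c => (hcont c).aestronglyMeasurable) hb
    hcont'.aestronglyMeasurable (Filter.Eventually.of_forall fun x c hc => hb' c hc x)
    (integrable_wt.const_mul C) (Filter.Eventually.of_forall fun x c _ => ha c x)).2

lemma heat_differentiable {f : E3 → ℝ} (hf : TF f) (c : ℝ) : Differentiable ℝ (heat f c) :=
  (contDiff_heat hf c).differentiable (by simp)

lemma integral_mul_heat_lap {F g : E3 → ℝ} (hF : Differentiable ℝ F) (hFb : BC F)
    (hFb' : ∀ i, BC (pd F i)) (hg : TF g) {c : ℝ} (hc : |c| ≤ 2) :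
    ∫ x, F x * heat (lap g) c x = - ∫ x, ∑ i, pd F i x * heat (pd g i) c x := by
  simp only [heat_lap hg, Finset.mul_sum]
  rw [integral_finsetSum, integral_finsetSum, ← Finset.sum_neg_distrib]
  · refine Finset.sum_congr rfl fun i _ => ?_
    rw [← pd_heat (hg.pd i)]
    refine integral_mul_pd i hF (heat_differentiable (hg.pd i) c) hFb (hFb' i)
      (dk_heat (hg.pd i) hc) ?_
    rw [pd_heat (hg.pd i)]
    exact dk_heat ((hg.pd i).pd i) hc
  · exact fun i _ => ((hFb' i).mul_dk (dk_heat (hg.pd i) hc)).integrable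
  · exact fun i _ => (hFb.mul_dk (dk_heat ((hg.pd i).pd i) hc)).integrable

lemma integral_heat_mul_heat_lap {f g : E3 → ℝ} (hf : TF f) (hg : TF g) {b c : ℝ} (hb : |b| ≤ 2)
    (hc : |c| ≤ 2) : ∫ x, heat f b x * heat (lap g) c x = ∫ x, heat (lap f) b x * heat g c x := by
  have h1 := integral_mul_heat_lap (heat_differentiable hf b) (dk_heat hf hb).bc
    (fun i => by rw [pd_heat hf]; exact (dk_heat (hf.pd i) hb).bc) hg hc
  have h2 := integral_mul_heat_lap (heat_differentiable hg c) (dk_heat hg hc).bc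
    (fun i => by rw [pd_heat hg]; exact (dk_heat (hg.pd i) hc).bc) hf hb
  rw [h1]
  simp only [mul_comm (heat (lap f) b _)]
  rw [h2]
  simp only [pd_heat hf, pd_heat hg, mul_comm]

/-- Symmetry and semigroup property of the heat semigroup. -/
lemma integral_mul_heat_sqrt_two {f g : E3 → ℝ} (hf : TF f) (hg : TF g) {c : ℝ}
    (hc : |c| ≤ 1) :
    ∫ x, f x * heat g (√2 * c) x = ∫ x, heat f c x * heat g c x := by
  set r := √2 * c with hr
  have h2 : √2 ≤ 2 := by rw [Real.sqrt_le_left (by norm_num)]; norm_num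
  have hr2 : |r| ≤ 2 := by
    rw [hr, abs_mul, abs_of_nonneg (Real.sqrt_nonneg 2)]
    nlinarith [abs_nonneg c, Real.sqrt_nonneg 2]
  have hsin : ∀ θ, |r * sin θ| ≤ 2 := fun θ => by
    rw [abs_mul]; nlinarith [abs_nonneg r, abs_sin_le_one θ, abs_nonneg (sin θ)]
  have hcos : ∀ θ, |r * cos θ| ≤ 2 := fun θ => by
    rw [abs_mul]; nlinarith [abs_nonneg r, abs_cos_le_one θ, abs_nonneg (cos θ)]
  obtain ⟨Cf, hCf, hf0⟩ := heat_decay hf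
  obtain ⟨Cg, hCg, hg0⟩ := heat_decay hg
  obtain ⟨Df, hDf, hf1⟩ := heat_decay hf.lap
  obtain ⟨Dg, hDg, hg1⟩ := heat_decay hg.lap
  have hder : ∀ θ, HasDerivAt
      (fun θ => ∫ x, heat f (r * sin θ) x * heat g (r * cos θ) x) 0 θ := by
    intro θ
    have h0 : ∫ x, (r * sin θ) * (r * cos θ) * (heat (lap f) (r * sin θ) x * heat g (r * cos θ) x
        - heat f (r * sin θ) x * heat (lap g) (r * cos θ) x) = 0 := by
      rw [integral_const_mul, integral_sub
        ((dk_heat hf.lap (hsin θ)).mul_bc (dk_heat hg (hcos θ)).bc).integrable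
        ((dk_heat hf (hsin θ)).mul_bc (dk_heat hg.lap (hcos θ)).bc).integrable,
        integral_heat_mul_heat_lap hf hg (hsin θ) (hcos θ)]
      simp
    rw [← h0]
    refine hasDerivAt_integral_of_le_wt (C := 4 * (Df * Cg + Cf * Dg)) (s := univ)
      (a' := fun θ x => (r * sin θ) * (r * cos θ) *
        (heat (lap f) (r * sin θ) x * heat g (r * cos θ) x
        - heat f (r * sin θ) x * heat (lap g) (r * cos θ) x))
      Filter.univ_mem (fun θ x => ?_) (fun θ => ?_) ?_ ?_ (fun θ _ x => ?_)
    · have h1 := (hasDerivAt_heat hf (r * sin θ) x).comp θ ((hasDerivAt_sin θ).const_mul r)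
      have h2 := (hasDerivAt_heat hg (r * cos θ) x).comp θ ((hasDerivAt_cos θ).const_mul r)
      have h3 := h1.mul h2
      refine HasDerivAt.congr_deriv h3 ?_
      simp only [Function.comp]
      ring
    · exact (contDiff_heat hf _).continuous.mul (contDiff_heat hg _).continuous
    · exact continuous_const.mul
        (((contDiff_heat hf.lap _).continuous.mul (contDiff_heat hg _).continuous).sub
        ((contDiff_heat hf _).continuous.mul (contDiff_heat hg.lap _).continuous))
    · exact ((dk_heat hf (hsin θ)).mul_bc (dk_heat hg (hcos θ)).bc).integrable
    · have hw := wt_le_one x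
      have hw0 := (wt_pos x).le
      have p1 : |heat (lap f) (r * sin θ) x * heat g (r * cos θ) x| ≤ Df * Cg * wt x := by
        rw [abs_mul]
        have := mul_le_mul (hf1 _ (hsin θ) x) ((hg0 _ (hcos θ) x).trans
          (mul_le_of_le_one_right hCg hw)) (abs_nonneg _) (by positivity)
        linarith
      have p2 : |heat f (r * sin θ) x * heat (lap g) (r * cos θ) x| ≤ Cf * Dg * wt x := by
        rw [abs_mul]
        have := mul_le_mul (hf0 _ (hsin θ) x) ((hg1 _ (hcos θ) x).trans
          (mul_le_of_le_one_right hDg hw)) (abs_nonneg _) (by positivity)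
        linarith
      have p3 := (abs_sub _ _).trans (add_le_add p1 p2)
      have p4 : |r * sin θ * (r * cos θ)| ≤ 4 := by
        rw [abs_mul]
        have := mul_le_mul (hsin θ) (hcos θ) (abs_nonneg _) (by norm_num)
        linarith
      rw [abs_mul]
      calc _ ≤ 4 * (Df * Cg * wt x + Cf * Dg * wt x) :=
            mul_le_mul p4 p3 (abs_nonneg _) (by norm_num)
        _ = _ := by ring
  have hconst := is_const_of_deriv_eq_zero (fun θ => (hder θ).differentiableAt)
    (fun θ => (hder θ).deriv) 0 (π / 4)
  simp only [sin_zero, cos_zero, mul_zero, mul_one, heat_zero, sin_pi_div_four,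
    cos_pi_div_four] at hconst
  rw [hconst]
  have : r * (√2 / 2) = c := by
    rw [hr]
    have := Real.mul_self_sqrt (show (0 : ℝ) ≤ 2 by norm_num)
    linear_combination (c / 2) * this
  rw [this]

/-! ### The Bellman-type energy -/

/-- Integral of the convex function `(g² + Φ + e²)^{3/2} - e³` of the heat extensions. -/
def energy (g Φ : E3 → ℝ) (e c : ℝ) : ℝ :=
  ∫ x, (√(heat g c x ^ 2 + heat Φ c x + e ^ 2) ^ 3 - e ^ 3)

lemma cube_sub_cube_le {a e m : ℝ} (he : 0 < e) (hm : e ≤ m) (ha : m ^ 2 = a + e ^ 2) :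
    m ^ 3 - e ^ 3 ≤ a * (m + e) := by
  have h0 : (m - e) * (m + e) = a := by linear_combination ha
  rw [← h0]
  nlinarith [mul_nonneg (sub_nonneg.2 hm) (mul_nonneg he.le (he.le.trans hm))]

lemma le_sqrt_add_sq {a e : ℝ} (ha : 0 ≤ a) : e ≤ √(a + e ^ 2) :=
  Real.le_sqrt_of_sq_le (by linarith)

lemma energy_nonneg {g Φ : E3 → ℝ} (hΦ0 : ∀ x, 0 ≤ Φ x) {e : ℝ} (he : 0 < e) (c : ℝ) :
    0 ≤ energy g Φ e c := by
  refine integral_nonneg fun x => sub_nonneg.2 (pow_le_pow_left₀ he.le ?_ 3)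
  exact le_sqrt_add_sq (add_nonneg (sq_nonneg _) (heat_nonneg hΦ0 c x))

lemma energy_deriv {g Φ : E3 → ℝ} (hg : TF g) (hΦ : TF Φ) (hΦ0 : ∀ x, 0 ≤ Φ x) {e : ℝ}
    (he : 0 < e) {c : ℝ} (hc0 : 0 ≤ c) (hc : c < 2) :
    ∃ d, HasDerivAt (energy g Φ e) d c ∧ ∀ i j,
      c * |∫ x, heat (pd Φ i) c x * heat (pd g j) c x| ≤ -d := by
  have hw0 : ∀ c x, 0 ≤ heat Φ c x := heat_nonneg hΦ0
  set m : ℝ → E3 → ℝ := fun c x => √(heat g c x ^ 2 + heat Φ c x + e ^ 2) with hm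
  have hpos : ∀ c x, 0 < heat g c x ^ 2 + heat Φ c x + e ^ 2 := fun c x => by
    have := hw0 c x; positivity
  have hmsq : ∀ c x, m c x ^ 2 = heat g c x ^ 2 + heat Φ c x + e ^ 2 := fun c x =>
    Real.sq_sqrt (hpos c x).le
  have hme : ∀ c x, e ≤ m c x := fun c x =>
    le_sqrt_add_sq (add_nonneg (sq_nonneg _) (hw0 c x))
  have hmpos : ∀ c x, 0 < m c x := fun c x => he.trans_le (hme c x)
  have hmcont : ∀ c, Continuous (m c) := fun c =>
    ((((contDiff_heat hg c).continuous.pow 2).add (contDiff_heat hΦ c).continuous).add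
      continuous_const).sqrt
  obtain ⟨Cg, hCg, hg0⟩ := heat_decay hg
  obtain ⟨CΦ, hCΦ, hΦb⟩ := heat_decay hΦ
  obtain ⟨Dg, hDg, hg1⟩ := heat_decay hg.lap
  obtain ⟨DΦ, hDΦ, hΦ1⟩ := heat_decay hΦ.lap
  set M := Cg + CΦ + 1 + e with hM
  have hM0 : 0 ≤ M := by positivity
  have hgb : ∀ c, |c| ≤ 2 → ∀ x, |heat g c x| ≤ Cg := fun c hc x =>
    (hg0 c hc x).trans (mul_le_of_le_one_right hCg (wt_le_one x))
  have hmM : ∀ c, |c| ≤ 2 → ∀ x, m c x ≤ M := fun c hc x => by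
    refine Real.sqrt_le_iff.2 ⟨hM0, ?_⟩
    have h1 : heat g c x ^ 2 ≤ Cg ^ 2 := by
      rw [← sq_abs]; exact pow_le_pow_left₀ (abs_nonneg _) (hgb c hc x) 2
    have h2 : heat Φ c x ≤ CΦ := ((le_abs_self _).trans (hΦb c hc x)).trans
      (mul_le_of_le_one_right hCΦ (wt_le_one x))
    have h3 : 0 ≤ Cg * CΦ := by positivity
    have h4 : 0 ≤ Cg * e := by positivity
    have h5 : 0 ≤ CΦ * e := by positivity
    rw [hM]
    nlinarith
  have hmBC : ∀ c, |c| ≤ 2 → BC (m c) := fun c hc => ⟨hmcont c, M, fun x => by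
    rw [abs_of_pos (hmpos c x)]; exact hmM c hc x⟩
  have hmiBC : ∀ c, |c| ≤ 2 → BC (fun x => (m c x)⁻¹) := fun c hc =>
    ⟨(hmcont c).inv₀ fun x => (hmpos c x).ne', e⁻¹, fun x => by
      rw [abs_of_pos (inv_pos.2 (hmpos c x))]; exact inv_anti₀ he (hme c x)⟩
  have habs : |c| ≤ 2 := by rw [abs_of_nonneg hc0]; exact hc.le
  set a' : ℝ → E3 → ℝ := fun c x =>
    c * (3 * (m c x * heat g c x) * heat (lap g) c x + 3 / 2 * m c x * heat (lap Φ) c x) with ha'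
  have hder : HasDerivAt (energy g Φ e) (∫ x, a' c x) c := by
    refine hasDerivAt_integral_of_le_wt (C := 2 * (3 * (M * Cg) * Dg + 3 / 2 * M * DΦ))
      (s := Icc (-2) 2) (Icc_mem_nhds (by linarith) hc) (fun c x => ?_) (fun c => ?_) ?_ ?_
      (fun c hc x => ?_)
    · have h1 := hasDerivAt_heat hg c x
      have h2 := hasDerivAt_heat hΦ c x
      have h3 := ((((h1.fun_pow 2).add h2).add_const (e ^ 2)).sqrt (hpos c x).ne')
      have h4 := (h3.fun_pow 3).sub_const (e ^ 3)
      refine h4.congr_deriv ?_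
      simp only [ha', hm]
      have hne : √(heat g c x ^ 2 + heat Φ c x + e ^ 2) ≠ 0 := (hmpos c x).ne'
      simp only [Pi.add_apply]
      field_simp
      ring
    · exact ((hmcont c).pow 3).sub continuous_const
    · exact continuous_const.mul (((continuous_const.mul ((hmcont c).mul
        (contDiff_heat hg c).continuous)).mul (contDiff_heat hg.lap c).continuous).add
        ((continuous_const.mul (hmcont c)).mul (contDiff_heat hΦ.lap c).continuous))
    · have hd : Dk (fun x => (heat g c x * heat g c x + heat Φ c x) * (m c x + e)) :=
        (((dk_heat hg habs).mul_bc (dk_heat hg habs).bc).add (dk_heat hΦ habs)).mul_bc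
          ((hmBC c habs).add (BC.const e))
      refine hd.integrable.mono' (((hmcont c).pow 3).sub continuous_const).aestronglyMeasurable
        (Filter.Eventually.of_forall fun x => ?_)
      rw [Real.norm_of_nonneg (sub_nonneg.2 (pow_le_pow_left₀ he.le (hme c x) 3))]
      exact cube_sub_cube_le he (hme c x) (by rw [hmsq]; ring)
    · have hcabs : |c| ≤ 2 := abs_le.2 hc
      simp only [ha']
      have q1 : |3 * (m c x * heat g c x) * heat (lap g) c x| ≤ 3 * (M * Cg) * (Dg * wt x) := by
        rw [abs_mul, abs_mul, abs_mul, abs_of_pos (hmpos c x)]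
        have := hmpos c x
        have q := mul_le_mul (hmM c hcabs x) (hgb c hcabs x) (abs_nonneg _) hM0
        refine mul_le_mul ?_ (hg1 c hcabs x) (abs_nonneg _) (by positivity)
        rw [abs_of_pos (by norm_num : (0 : ℝ) < 3)]
        linarith
      have q2 : |3 / 2 * m c x * heat (lap Φ) c x| ≤ 3 / 2 * M * (DΦ * wt x) := by
        rw [abs_mul, abs_mul, abs_of_pos (hmpos c x)]
        refine mul_le_mul ?_ (hΦ1 c hcabs x) (abs_nonneg _) (by positivity)
        rw [abs_of_pos (by norm_num : (0 : ℝ) < 3 / 2)]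
        have := hmM c hcabs x
        linarith
      have q3 := mul_le_mul hcabs ((abs_add_le _ _).trans (add_le_add q1 q2)) (abs_nonneg _)
        (by norm_num)
      rw [abs_mul]
      linarith
  refine ⟨_, hder, ?_⟩
  set v := heat g c with hv
  set w := heat Φ c with hw
  have hvd : Differentiable ℝ v := heat_differentiable hg c
  have hwd : Differentiable ℝ w := heat_differentiable hΦ c
  have hvi : ∀ i, pd v i = heat (pd g i) c := pd_heat hg c
  have hwi : ∀ i, pd w i = heat (pd Φ i) c := pd_heat hΦ c
  have hvi' : ∀ i, Dk (pd v i) := fun i => by rw [hvi]; exact dk_heat (hg.pd i) habs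
  have hwi' : ∀ i, Dk (pd w i) := fun i => by rw [hwi]; exact dk_heat (hΦ.pd i) habs
  have hvk : Dk v := dk_heat hg habs
  set q : Fin 3 → E3 → ℝ := fun i x => v x * pd v i x + 1 / 2 * pd w i x with hq
  have hqk : ∀ i, Dk (q i) := fun i => (hvk.bc.mul_dk (hvi' i)).add ((hwi' i).const_mul _)
  have hmd : Differentiable ℝ (m c) := fun x =>
    DifferentiableAt.sqrt (DifferentiableAt.add_const (e ^ 2)
      (((hvd x).fun_pow 2).fun_add (hwd x))) (hpos c x).ne'
  have hpm : ∀ i x, pd (m c) i x = (m c x)⁻¹ * q i x := fun i x => by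
    have hin : DifferentiableAt ℝ (fun x => v x * v x + w x) x := ((hvd x).fun_mul (hvd x)).fun_add (hwd x)
    have h1 : HasDerivAt (fun t : ℝ => √(t + e ^ 2)) (1 / (2 * m c x)) (v x * v x + w x) := by
      have := ((hasDerivAt_id (v x * v x + w x)).add_const (e ^ 2)).sqrt
        (by have := hpos c x; simp only [id]; rw [← sq]; exact this.ne')
      simpa [hm, ← sq] using this
    have h2 := pd_comp h1 hin i
    have h3 : m c = fun y => √(v y * v y + w y + e ^ 2) := by
      funext y; simp only [hm, ← sq]; rfl
    rw [pd_add ((hvd x).fun_mul (hvd x)) (hwd x), pd_mul (hvd x) (hvd x)] at h2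
    have h4 : pd (m c) i x = pd (fun y => √(v y * v y + w y + e ^ 2)) i x := by rw [h3]
    rw [h4, h2]
    have hne := (hmpos c x).ne'
    simp only [hq]
    field_simp
    ring
  have hpmBC : ∀ i, BC (pd (m c) i) := fun i => by
    have : pd (m c) i = fun x => (m c x)⁻¹ * q i x := funext (hpm i)
    rw [this]
    exact ((hmiBC c habs).mul_dk (hqk i)).bc
  have hmvd : Differentiable ℝ (fun x => m c x * v x) := hmd.fun_mul hvd
  have hpmv : ∀ i x, pd (fun x => m c x * v x) i x
      = m c x * pd v i x + (m c x)⁻¹ * q i x * v x := fun i x => by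
    rw [pd_mul (hmd x) (hvd x), hpm]
  have hpmvBC : ∀ i, BC (pd (fun x => m c x * v x) i) := fun i => by
    have : pd (fun x => m c x * v x) i = fun x => m c x * pd v i x + pd (m c) i x * v x :=
      funext fun x => pd_mul (hmd x) (hvd x) i
    rw [this]
    exact ((hmBC c habs).mul (hvi' i).bc).add ((hpmBC i).mul hvk.bc)
  have I1 := integral_mul_heat_lap hmvd ((hmBC c habs).mul hvk.bc) hpmvBC hg habs
  have I2 := integral_mul_heat_lap hmd (hmBC c habs) hpmBC hΦ habs
  set form : E3 → ℝ := fun x =>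
    ∑ i, (3 * (m c x * (pd v i x * pd v i x)) + 3 * ((m c x)⁻¹ * (q i x * q i x))) with hform
  have hformk : Dk form := Dk.sum _ fun i _ =>
    (((hmBC c habs).mul_dk ((hvi' i).mul_bc (hvi' i).bc)).const_mul 3).add
      (((hmiBC c habs).mul_dk ((hqk i).mul_bc (hqk i).bc)).const_mul 3)
  have hval : ∫ x, a' c x = -(c * ∫ x, form x) := by
    have e1 : ∀ x, a' c x = c * (3 * (m c x * v x * heat (lap g) c x)
        + 3 / 2 * (m c x * heat (lap Φ) c x)) := fun x => by
      simp only [ha']; ring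
    rw [integral_congr_ae (Filter.Eventually.of_forall e1), integral_const_mul,
      integral_add, integral_const_mul, integral_const_mul, I1, I2]
    · have e2 : ∀ x, form x = 3 * (∑ i, pd (fun x => m c x * v x) i x * heat (pd g i) c x)
          + 3 / 2 * ∑ i, pd (m c) i x * heat (pd Φ i) c x := fun x => by
        simp only [hform, Finset.mul_sum, ← Finset.sum_add_distrib, hpmv, hpm, ← hvi, ← hwi]
        refine Finset.sum_congr rfl fun i _ => ?_
        simp only [hq]
        ring
      rw [integral_congr_ae (Filter.Eventually.of_forall e2), integral_add, integral_const_mul,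
        integral_const_mul]
      · ring
      · exact ((Dk.sum _ fun i _ => (hpmvBC i).mul_dk (dk_heat (hg.pd i) habs)).const_mul
          3).integrable
      · exact ((Dk.sum _ fun i _ => (hpmBC i).mul_dk (dk_heat (hΦ.pd i) habs)).const_mul
          (3 / 2)).integrable
    · exact ((((hmBC c habs).mul hvk.bc).mul_dk (dk_heat hg.lap habs)).const_mul 3).integrable
    · exact (((hmBC c habs).mul_dk (dk_heat hΦ.lap habs)).const_mul (3 / 2)).integrable
  intro i j
  rw [hval, neg_neg]
  refine mul_le_mul_of_nonneg_left ?_ hc0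
  rw [← hvi, ← hwi, ← Real.norm_eq_abs]
  refine norm_integral_le_of_norm_le hformk.integrable (Filter.Eventually.of_forall fun x => ?_)
  rw [norm_mul, Real.norm_eq_abs, Real.norm_eq_abs]
  have hmx := hmpos c x
  have hvm : |v x| ≤ m c x := by
    refine Real.abs_le_sqrt ?_
    have := hw0 c x
    nlinarith [sq_nonneg e]
  have hw2 : |pd w i x| ≤ 2 * |q i x| + 2 * (m c x * |pd v i x|) := by
    have : pd w i x = 2 * q i x - 2 * (v x * pd v i x) := by simp only [hq]; ring
    rw [this]
    refine (abs_sub _ _).trans ?_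
    rw [abs_mul, abs_mul, abs_mul, abs_two]
    have := mul_le_mul_of_nonneg_right hvm (abs_nonneg (pd v i x))
    linarith
  have t1 : 2 * |q i x| * |pd v j x| ≤ m c x * (pd v j x * pd v j x)
      + (m c x)⁻¹ * (q i x * q i x) := by
    have hsq : 0 ≤ (m c x)⁻¹ * (|q i x| - m c x * |pd v j x|) ^ 2 := by positivity
    have e1 : (m c x)⁻¹ * (|q i x| - m c x * |pd v j x|) ^ 2 =
        (m c x)⁻¹ * (q i x * q i x) - 2 * |q i x| * |pd v j x|
          + m c x * (pd v j x * pd v j x) := by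
      rw [← abs_mul_abs_self (q i x), ← abs_mul_abs_self (pd v j x)]
      field_simp
      ring
    linarith
  have t2 : 2 * (m c x * |pd v i x|) * |pd v j x| ≤
      m c x * (pd v i x * pd v i x) + m c x * (pd v j x * pd v j x) := by
    rw [← abs_mul_abs_self (pd v i x), ← abs_mul_abs_self (pd v j x)]
    nlinarith [mul_nonneg hmx.le (sq_nonneg (|pd v i x| - |pd v j x|))]
  have t3 : |pd w i x| * |pd v j x| ≤ 2 * |q i x| * |pd v j x|
      + 2 * (m c x * |pd v i x|) * |pd v j x| := by
    rw [← add_mul]; exact mul_le_mul_of_nonneg_right hw2 (abs_nonneg _)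
  have hA : ∀ k, 0 ≤ m c x * (pd v k x * pd v k x) := fun k =>
    mul_nonneg hmx.le (mul_self_nonneg _)
  have hB : ∀ k, 0 ≤ (m c x)⁻¹ * (q k x * q k x) := fun k =>
    mul_nonneg (inv_pos.2 hmx).le (mul_self_nonneg _)
  have sA : ∀ k, m c x * (pd v k x * pd v k x) ≤ ∑ l, m c x * (pd v l x * pd v l x) := fun k =>
    Finset.single_le_sum (f := fun l => m c x * (pd v l x * pd v l x)) (fun l _ => hA l)
      (Finset.mem_univ k)
  have sB : (m c x)⁻¹ * (q i x * q i x) ≤ ∑ l, (m c x)⁻¹ * (q l x * q l x) :=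
    Finset.single_le_sum (f := fun l => (m c x)⁻¹ * (q l x * q l x)) (fun l _ => hB l)
      (Finset.mem_univ i)
  have sF : form x = 3 * ∑ l, m c x * (pd v l x * pd v l x)
      + 3 * ∑ l, (m c x)⁻¹ * (q l x * q l x) := by
    simp only [hform, Finset.sum_add_distrib, Finset.mul_sum]
  have s0 := hB i
  rw [sF]
  linarith [sA i, sA j]

lemma TF.integrable_comp {f : E3 → ℝ} (hf : TF f) {φ : ℝ → ℝ} (hφ : Continuous φ)
    (h0 : φ 0 = 0) : Integrable (fun x => φ (f x)) :=
  (hφ.comp hf.1.continuous).integrable_of_hasCompactSupport (hf.2.comp_left h0)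

lemma sum_sq_mul_sum_le {p s : ℝ} (hp : 0 ≤ p) (hs : 0 ≤ s) :
    (p ^ 2 + s ^ 2) * (p + s) ≤ 2 * (p ^ 3 + s ^ 3) := by
  nlinarith [mul_nonneg (sq_nonneg (p - s)) (add_nonneg hp hs)]

lemma energy_zero_le {g Φ : E3 → ℝ} (hg : TF g) (hΦ : TF Φ) (hΦ0 : ∀ x, 0 ≤ Φ x) {e : ℝ}
    (he : 0 < e) :
    energy g Φ e 0 ≤ 2 * ((∫ x, |g x| ^ 3) + ∫ x, √(Φ x) ^ 3)
      + e * (2 * ((∫ x, g x ^ 2) + ∫ x, Φ x)) := by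
  have i1 : Integrable (fun x => |g x| ^ 3) :=
    hg.integrable_comp (φ := fun t => |t| ^ 3) (by fun_prop) (by simp)
  have i2 : Integrable (fun x => √(Φ x) ^ 3) :=
    hΦ.integrable_comp (φ := fun t => √t ^ 3) (by fun_prop) (by simp)
  have i3 : Integrable (fun x => g x ^ 2) :=
    hg.integrable_comp (φ := fun t => t ^ 2) (by fun_prop) (by simp)
  have i4 : Integrable Φ := hΦ.dk.integrable
  have i5 : Integrable (fun x => 2 * (|g x| ^ 3 + √(Φ x) ^ 3)) := (i1.add i2).const_mul 2
  have i6 : Integrable (fun x => e * (2 * (g x ^ 2 + Φ x))) :=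
    ((i3.add i4).const_mul 2).const_mul e
  rw [← integral_add i1 i2, ← integral_add i3 i4, ← integral_const_mul, ← integral_const_mul,
    ← integral_const_mul, ← integral_add i5 i6]
  refine integral_mono_of_nonneg (Filter.Eventually.of_forall fun x => ?_)
    (i5.add i6) (Filter.Eventually.of_forall fun x => ?_)
  · refine sub_nonneg.2 (pow_le_pow_left₀ he.le ?_ 3)
    exact le_sqrt_add_sq (add_nonneg (sq_nonneg _) (heat_nonneg hΦ0 0 x))
  · simp only [heat_zero]
    have hs := Real.sq_sqrt (hΦ0 x)
    set s := √(Φ x) with hsdef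
    have hs0 : 0 ≤ s := Real.sqrt_nonneg _
    have hp0 := abs_nonneg (g x)
    rw [← hs, ← sq_abs (g x)]
    set p := |g x|
    have hae : 0 ≤ p ^ 2 + s ^ 2 := by positivity
    have hm := Real.sq_sqrt (add_nonneg hae (sq_nonneg e))
    have hme : e ≤ √(p ^ 2 + s ^ 2 + e ^ 2) := le_sqrt_add_sq hae
    have hle : √(p ^ 2 + s ^ 2 + e ^ 2) ≤ p + s + e := by
      refine Real.sqrt_le_iff.2 ⟨by positivity, ?_⟩
      nlinarith [mul_nonneg hp0 hs0, mul_nonneg hp0 he.le, mul_nonneg hs0 he.le]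
    have h1 := cube_sub_cube_le he hme hm
    have h2 := mul_le_mul_of_nonneg_left hle hae
    have h3 := sum_sq_mul_sum_le hp0 hs0
    linarith

lemma integral_mul_heat_pd_pd {f g : E3 → ℝ} (hf : TF f) (hg : TF g) {c : ℝ} (hc : |c| ≤ 1)
    (i j : Fin 3) :
    ∫ x, f x * heat (pd (pd g j) i) (√2 * c) x
      = -∫ x, heat (pd f i) c x * heat (pd g j) c x := by
  have hc2 : |c| ≤ 2 := hc.trans (by norm_num)
  rw [integral_mul_heat_sqrt_two hf ((hg.pd j).pd i) hc, ← pd_heat (hg.pd j), ← pd_heat hf]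
  refine integral_mul_pd i (heat_differentiable hf c) (heat_differentiable (hg.pd j) c)
    (dk_heat hf hc2).bc ?_ (dk_heat (hg.pd j) hc2) ?_
  · rw [pd_heat hf]; exact (dk_heat (hf.pd i) hc2).bc
  · rw [pd_heat (hg.pd j)]; exact dk_heat ((hg.pd j).pd i) hc2

lemma abs_integral_mul_comp_le {k g : E3 → ℝ} (hg : TF g) {c B : ℝ} (hc : 0 < c) {x : E3}
    (hk : ∀ z, g (x - c • z) ≠ 0 → |k z| ≤ B * c ^ 3) :
    |∫ z, k z * g (x - c • z)| ≤ B * ∫ y, |g y| := by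
  have hch : ∫ z, B * c ^ 3 * |g (x - c • z)| = B * ∫ y, |g y| := by
    rw [integral_const_mul, Measure.integral_comp_smul volume (fun y => |g (x - y)|) c,
      integral_sub_left_eq_self (fun y => |g y|) volume x]
    have : Module.finrank ℝ E3 = 3 := by simp [E3]
    rw [this, abs_of_pos (by positivity), smul_eq_mul]
    field_simp
  rw [← hch, ← Real.norm_eq_abs]
  have hint : Integrable (fun z => |g (x - c • z)|) := by
    have h1 : Integrable (fun y => |g (x - y)|) := hg.dk.integrable.abs.comp_sub_left x
    exact h1.comp_smul hc.ne'
  refine norm_integral_le_of_norm_le (hint.const_mul _) (Filter.Eventually.of_forall fun z => ?_)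
  rw [Real.norm_eq_abs, abs_mul]
  by_cases h : g (x - c • z) = 0
  · simp [h]
  · exact mul_le_mul_of_nonneg_right (hk z h) (abs_nonneg _)

lemma exists_heat_bound : ∃ K, 0 ≤ K ∧ ∀ g, TF g → (∀ y, g y ≠ 0 → ‖y‖ ≤ 1 / 4) →
    (∀ c x, 0 < c → 1 / 2 ≤ ‖x‖ → |heat g c x| ≤ K * ∫ y, |g y|) ∧
    (∀ c x i, 0 < c → 1 / 2 ≤ ‖x‖ → |heat (pd g i) c x| ≤ K * ∫ y, |g y|) ∧
    (∀ c x, 1 ≤ c → |heat g c x| ≤ K * ∫ y, |g y|) := by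
  obtain ⟨K, hK, hb⟩ := gam_bound
  have hpow : ∀ (z : E3) n, n ≤ 8 → gam z * ‖z‖ ^ n ≤ K := fun z n hn => by
    refine le_trans (mul_le_mul_of_nonneg_left ?_ (gam_pos z).le) (hb z)
    have := norm_nonneg z
    calc ‖z‖ ^ n ≤ (1 + 2 * ‖z‖) ^ n := pow_le_pow_left₀ this (by linarith) n
      _ ≤ (1 + 2 * ‖z‖) ^ 8 := pow_le_pow_right₀ (by linarith) hn
  refine ⟨256 * K, by positivity, fun g hg hs => ?_⟩
  have hfar : ∀ (c : ℝ) (x z : E3), 0 < c → 1 / 2 ≤ ‖x‖ → g (x - c • z) ≠ 0 →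
      1 ≤ 4 * (c * ‖z‖) := fun c x z hc hx hz => by
    have h1 := hs _ hz
    have h2 := norm_sub_norm_le x (c • z)
    rw [norm_smul, Real.norm_of_nonneg hc.le] at h2
    linarith
  have hcube : ∀ (c : ℝ) (x z : E3), 0 < c → 1 / 2 ≤ ‖x‖ → g (x - c • z) ≠ 0 → ∀ n ≤ 5,
      gam z * ‖z‖ ^ n ≤ 64 * K * c ^ 3 := fun c x z hc hx hz n hn => by
    have h1 := one_le_pow₀ (hfar c x z hc hx hz) (n := 3)
    have h0 : 0 ≤ gam z * ‖z‖ ^ n := mul_nonneg (gam_pos z).le (by positivity)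
    calc gam z * ‖z‖ ^ n ≤ gam z * ‖z‖ ^ n * (4 * (c * ‖z‖)) ^ 3 := le_mul_of_one_le_right h0 h1
      _ = 64 * c ^ 3 * (gam z * ‖z‖ ^ (n + 3)) := by ring
      _ ≤ 64 * c ^ 3 * K := mul_le_mul_of_nonneg_left (hpow z _ (by omega)) (by positivity)
      _ = _ := by ring
  refine ⟨fun c x hc hx => ?_, fun c x i hc hx => ?_, fun c x hc => ?_⟩
  · refine abs_integral_mul_comp_le hg hc fun z hz => ?_
    rw [abs_of_pos (gam_pos z)]
    have := hcube c x z hc hx hz 0 (by norm_num)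
    have : 0 ≤ K * c ^ 3 := by positivity
    linarith
  · have h1 : heat (pd g i) c x = ∫ z, (c⁻¹ * pd gam i z) * g (x - c • z) := by
      have := integral_pd_gam_mul hg c x i
      simp only [mul_assoc]
      rw [integral_const_mul]
      simp only [mul_comm (pd gam i _)]
      rw [this]
      field_simp
    rw [h1]
    refine abs_integral_mul_comp_le hg hc fun z hz => ?_
    rw [pd_gam, abs_mul, abs_mul, abs_neg, abs_of_pos (gam_pos z), abs_of_pos (inv_pos.2 hc)]
    have h2 := hfar c x z hc hx hz
    have h3 : c⁻¹ ≤ 4 * ‖z‖ := by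
      rw [inv_le_iff_one_le_mul₀ hc]; linarith
    have h4 := hcube c x z hc hx hz 2 (by norm_num)
    calc c⁻¹ * (|z i| * gam z) ≤ 4 * ‖z‖ * (‖z‖ * gam z) := by
          refine mul_le_mul h3 (mul_le_mul_of_nonneg_right (abs_coord_le z i) (gam_pos z).le)
            (mul_nonneg (abs_nonneg _) (gam_pos z).le) (by positivity)
      _ = 4 * (gam z * ‖z‖ ^ 2) := by ring
      _ ≤ _ := by linarith
  · refine abs_integral_mul_comp_le hg (by linarith) fun z _ => ?_
    rw [abs_of_pos (gam_pos z)]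
    have h1 := hpow z 0 (by norm_num)
    have h2 : K ≤ K * c ^ 3 := le_mul_of_one_le_right hK.le (one_le_pow₀ hc)
    linarith

lemma TF.const_mul {f : E3 → ℝ} (hf : TF f) (c : ℝ) : TF (fun x => c * f x) := by
  have := hf.mul (g := fun _ => c) contDiff_const
  simpa only [mul_comm] using this

lemma exists_bump {r R : ℝ} (hr : 0 < r) (hrR : r < R) : ∃ χ : E3 → ℝ, TF χ ∧ (∀ x, 0 ≤ χ x) ∧
    (∀ x, χ x ≤ 1) ∧ (∀ x, ‖x‖ ≤ r → χ x = 1) ∧ ∀ x, R ≤ ‖x‖ → χ x = 0 := by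
  let b : ContDiffBump (0 : E3) := ⟨r, R, hr, hrR⟩
  refine ⟨b, ⟨b.contDiff, b.hasCompactSupport⟩, fun x => b.nonneg, fun x => b.le_one,
    fun x hx => b.one_of_mem_closedBall (by simpa using hx), fun x hx => ?_⟩
  exact b.zero_of_le_dist (by simpa using hx)

lemma pd_eventuallyEq {f g : E3 → ℝ} {x : E3} (h : f =ᶠ[nhds x] g) (i : Fin 3) :
    pd f i =ᶠ[nhds x] pd g i :=
  (h.fderiv (𝕜 := ℝ)).mono fun y hy => by simp only [pd, hy]

lemma pd_const (a : ℝ) (i : Fin 3) (x : E3) : pd (fun _ => a) i x = 0 := by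
  simp [pd]

lemma TF.integral_mul_pd {f g : E3 → ℝ} (hf : TF f) (hg : TF g) (i : Fin 3) :
    ∫ x, f x * _root_.pd g i x = -∫ x, _root_.pd f i x * g x :=
  _root_.integral_mul_pd i hf.differentiable hg.differentiable hf.dk.bc (hf.pd i).dk.bc hg.dk
    (hg.pd i).dk

lemma TF.integral_mul_lap {f g : E3 → ℝ} (hf : TF f) (hg : TF g) :
    ∫ x, f x * _root_.lap g x = ∫ x, _root_.lap f x * g x := by
  have := integral_heat_mul_heat_lap hf hg (b := 0) (c := 0) (by simp) (by simp)
  simpa only [heat_zero] using this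

lemma pd_pd_mul {f g : E3 → ℝ} (hf : ContDiff ℝ (⊤ : ℕ∞) f) (hg : ContDiff ℝ (⊤ : ℕ∞) g)
    (i j : Fin 3) (x : E3) :
    pd (pd (fun x => f x * g x) i) j x = f x * pd (pd g i) j x + pd f j x * pd g i x
      + pd f i x * pd g j x + pd (pd f i) j x * g x := by
  have df := hf.differentiable (by simp)
  have dg := hg.differentiable (by simp)
  have dfi := (contDiff_pd hf i).differentiable (by simp)
  have dgi := (contDiff_pd hg i).differentiable (by simp)
  have h1 : pd (fun x => f x * g x) i = fun x => f x * pd g i x + pd f i x * g x :=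
    funext fun x => pd_mul (df x) (dg x) i
  rw [h1, pd_add ((df x).fun_mul (dgi x)) ((dfi x).fun_mul (dg x)), pd_mul (df x) (dgi x),
    pd_mul (dfi x) (dg x)]
  ring

lemma sum_abs_mul_le (a : Fin 3 → ℝ) : ∑ i, ∑ j, |a i * a j| ≤ 3 * ∑ i, a i ^ 2 := by
  simp only [Fin.sum_univ_three, abs_mul, ← sq_abs (a _)]
  nlinarith [sq_nonneg (|a 0| - |a 1|), sq_nonneg (|a 0| - |a 2|), sq_nonneg (|a 1| - |a 2|)]

lemma abs_weak_form_le {χ v P : E3 → ℝ} {u : Fin 3 → E3 → ℝ} (hχ : TF χ)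
    (hv : ContDiff ℝ (⊤ : ℕ∞) v) (hP : TF P) (hu : ∀ i, TF (u i))
    (heq : ∀ x, χ x ≠ 0 →
      lap P x = -∑ i, ∑ j, pd (pd (fun y => u i y * u j y) j) i x) {M : ℝ}
    (h1 : ∀ x i j, |pd χ i x * pd v j x| ≤ M) (h2 : ∀ x i j, |pd (pd χ i) j x * v x| ≤ M) :
    |(∫ x, χ x * P x * lap v x)
      + ∑ i, ∑ j, ∫ x, χ x * (u i x * u j x) * pd (pd v i) j x|
      ≤ 9 * M * ((∫ x, |P x|) + ∫ x, ∑ i, u i x ^ 2) := by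
  have huu : ∀ i j, TF (fun x => u i x * u j x) := fun i j => (hu i).mul (hu j).1
  have hvij : ∀ i j, ContDiff ℝ (⊤ : ℕ∞) (pd (pd v i) j) := fun i j =>
    contDiff_pd (contDiff_pd hv i) j
  have hlv : ContDiff ℝ (⊤ : ℕ∞) (lap v) := ContDiff.sum fun i _ => hvij i i
  have hφ : TF (fun x => χ x * v x) := hχ.mul hv
  have hE : ∫ x, (P x * lap (fun x => χ x * v x) x
      + ∑ i, ∑ j, u i x * u j x * pd (pd (fun x => χ x * v x) i) j x) = 0 := by
    have e1 : ∀ i j, ∫ x, u i x * u j x * pd (pd (fun x => χ x * v x) i) j x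
        = ∫ x, pd (pd (fun x => u i x * u j x) j) i x * (χ x * v x) := fun i j => by
      rw [(huu i j).integral_mul_pd (hφ.pd i) j, ((huu i j).pd j).integral_mul_pd hφ i, neg_neg]
    have k1 : ∀ i j, Integrable
        (fun x => u i x * u j x * pd (pd (fun x => χ x * v x) i) j x) := fun i j =>
      ((huu i j).mul ((hφ.pd i).pd j).1).dk.integrable
    have k2 : ∀ i j, Integrable
        (fun x => pd (pd (fun x => u i x * u j x) j) i x * (χ x * v x)) := fun i j =>
      ((((huu i j).pd j).pd i).mul hφ.1).dk.integrable
    rw [integral_add (hP.mul hφ.lap.1).dk.integrable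
      (integrable_finsetSum _ fun i _ => integrable_finsetSum _ fun j _ => k1 i j),
      hP.integral_mul_lap hφ, integral_finsetSum _
      (fun i _ => integrable_finsetSum _ fun j _ => k1 i j)]
    have e2 : ∀ x, lap P x * (χ x * v x)
        = -∑ i, ∑ j, pd (pd (fun x => u i x * u j x) j) i x * (χ x * v x) := fun x => by
      by_cases hx : χ x = 0
      · simp [hx]
      · rw [heq x hx]; simp only [Finset.sum_mul, neg_mul]
    rw [integral_congr_ae (Filter.Eventually.of_forall e2), integral_neg, integral_finsetSum _
      (fun i _ => integrable_finsetSum _ fun j _ => k2 i j), neg_add_eq_zero]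
    refine Finset.sum_congr rfl fun i _ => ?_
    rw [integral_finsetSum _ (fun j _ => k2 i j), integral_finsetSum _ (fun j _ => k1 i j)]
    exact Finset.sum_congr rfl fun j _ => (e1 i j).symm
  set A : E3 → ℝ := fun x => χ x * P x * lap v x
    + ∑ i, ∑ j, χ x * (u i x * u j x) * pd (pd v i) j x with hA
  have k3 : ∀ i j, Integrable (fun x => χ x * (u i x * u j x) * pd (pd v i) j x) := fun i j =>
    ((hχ.mul (huu i j).1).mul (hvij i j)).dk.integrable
  have hA0 : (∫ x, χ x * P x * lap v x)
      + ∑ i, ∑ j, ∫ x, χ x * (u i x * u j x) * pd (pd v i) j x = ∫ x, A x := by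
    rw [hA, integral_add ((hχ.mul hP.1).mul hlv).dk.integrable
      (integrable_finsetSum _ fun i _ => integrable_finsetSum _ fun j _ => k3 i j),
      integral_finsetSum _ (fun i _ => integrable_finsetSum _ fun j _ => k3 i j)]
    congr 1
    refine Finset.sum_congr rfl fun i _ => ?_
    rw [integral_finsetSum _ (fun j _ => k3 i j)]
  have hAi : Integrable A := ((hχ.mul hP.1).mul hlv).dk.integrable.add
    (integrable_finsetSum _ fun i _ => integrable_finsetSum _ fun j _ => k3 i j)
  have hBi : Integrable (fun x => P x * lap (fun x => χ x * v x) x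
      + ∑ i, ∑ j, u i x * u j x * pd (pd (fun x => χ x * v x) i) j x) :=
    (hP.mul hφ.lap.1).dk.integrable.add (integrable_finsetSum _ fun i _ =>
      integrable_finsetSum _ fun j _ => ((huu i j).mul ((hφ.pd i).pd j).1).dk.integrable)
  have hs : Integrable (fun x => ∑ i, u i x ^ 2) := integrable_finsetSum _ fun i _ =>
    (hu i).integrable_comp (φ := fun t => t ^ 2) (by fun_prop) (by simp)
  have hPi : Integrable (fun x => |P x|) := hP.dk.integrable.abs
  rw [hA0, ← sub_zero (∫ x, A x), ← hE, ← integral_sub hAi hBi, ← integral_add hPi hs,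
    ← integral_const_mul, ← Real.norm_eq_abs]
  refine norm_integral_le_of_norm_le ((hPi.add hs).const_mul _)
    (Filter.Eventually.of_forall fun x => ?_)
  have hM : 0 ≤ M := (abs_nonneg _).trans (h2 x 0 0)
  have t1 : ∀ i j, |pd χ j x * pd v i x + pd χ i x * pd v j x + pd (pd χ i) j x * v x| ≤ 3 * M :=
    fun i j => by
      refine (abs_add_le _ _).trans ((add_le_add_left (abs_add_le _ _) _).trans ?_)
      linarith [h1 x i j, h1 x j i, h2 x i j]
  have e3 : A x - (P x * lap (fun x => χ x * v x) x
      + ∑ i, ∑ j, u i x * u j x * pd (pd (fun x => χ x * v x) i) j x)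
      = -(∑ i, P x * (pd χ i x * pd v i x + pd χ i x * pd v i x + pd (pd χ i) i x * v x)
        + ∑ i, ∑ j, u i x * u j x *
          (pd χ j x * pd v i x + pd χ i x * pd v j x + pd (pd χ i) j x * v x)) := by
    have e4 : lap (fun x => χ x * v x) x = ∑ i, pd (pd (fun x => χ x * v x) i) i x := rfl
    have e5 : lap v x = ∑ i, pd (pd v i) i x := rfl
    simp only [hA, e4, e5, pd_pd_mul hχ.1 hv, Fin.sum_univ_three]
    ring
  rw [Real.norm_eq_abs, e3, abs_neg]
  have s1 : |∑ i, P x * (pd χ i x * pd v i x + pd χ i x * pd v i x + pd (pd χ i) i x * v x)|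
      ≤ ∑ _i : Fin 3, |P x| * (3 * M) := by
    refine (Finset.abs_sum_le_sum_abs _ _).trans (Finset.sum_le_sum fun i _ => ?_)
    rw [abs_mul]
    exact mul_le_mul_of_nonneg_left (t1 i i) (abs_nonneg _)
  have s2 : |∑ i, ∑ j, u i x * u j x *
          (pd χ j x * pd v i x + pd χ i x * pd v j x + pd (pd χ i) j x * v x)|
      ≤ ∑ i, ∑ j, |u i x * u j x| * (3 * M) := by
    refine (Finset.abs_sum_le_sum_abs _ _).trans (Finset.sum_le_sum fun i _ => ?_)
    refine (Finset.abs_sum_le_sum_abs _ _).trans (Finset.sum_le_sum fun j _ => ?_)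
    rw [abs_mul]
    exact mul_le_mul_of_nonneg_left (t1 i j) (abs_nonneg _)
  simp only [← Finset.sum_mul] at s2
  have s3 := mul_le_mul_of_nonneg_right (sum_abs_mul_le fun i => u i x)
    (by positivity : 0 ≤ 3 * M)
  simp only [Finset.sum_const, Finset.card_univ, Fintype.card_fin, nsmul_eq_mul] at s1
  refine (abs_add_le _ _).trans ?_
  push_cast at s1
  linarith

lemma abs_mul_le_sum_sq (a : Fin 3 → ℝ) (i j : Fin 3) : |a i * a j| ≤ ∑ k, a k ^ 2 := by
  have h1 : ∀ i, a i ^ 2 ≤ ∑ k, a k ^ 2 := fun i =>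
    Finset.single_le_sum (f := fun k => a k ^ 2) (fun k _ => sq_nonneg _) (Finset.mem_univ i)
  rw [abs_mul]
  have h2 := h1 i
  have h3 := h1 j
  rw [← sq_abs] at h2 h3
  nlinarith [sq_nonneg (|a i| - |a j|)]

lemma sqrt_cube_le {a s : ℝ} (ha : a ≤ 2 * s) : √a ^ 3 ≤ 4 * √s ^ 3 := by
  have h1 : √a ≤ √2 * √s := by
    rw [← Real.sqrt_mul (by norm_num)]; exact Real.sqrt_le_sqrt ha
  have h2 : √2 ^ 3 ≤ 4 := by
    have := Real.sq_sqrt (show (0 : ℝ) ≤ 2 by norm_num)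
    have h3 : √2 ≤ 2 := by rw [Real.sqrt_le_left (by norm_num)]; norm_num
    calc √2 ^ 3 = √2 ^ 2 * √2 := by ring
      _ ≤ 4 := by rw [this]; linarith
  calc √a ^ 3 ≤ (√2 * √s) ^ 3 := pow_le_pow_left₀ (Real.sqrt_nonneg _) h1 3
    _ = √2 ^ 3 * √s ^ 3 := by ring
    _ ≤ _ := mul_le_mul_of_nonneg_right h2 (by positivity)

lemma le_of_forall_le_add_mul {a b k : ℝ} (h : ∀ e > 0, a ≤ b + e * k) : a ≤ b := by
  refine le_of_forall_pos_le_add fun ε hε => ?_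
  have := h (ε / (|k| + 1)) (by positivity)
  refine this.trans (add_le_add le_rfl ?_)
  rw [div_mul_eq_mul_div, div_le_iff₀ (by positivity)]
  exact mul_le_mul_of_nonneg_left ((le_abs_self k).trans (by linarith)) hε.le

/-- Derivative of a time-rescaled pairing with the heat semigroup. -/
lemma hasDerivAt_integral_heat_sqrt_two {F g : E3 → ℝ} (hF : TF F) (hg : TF g) {c : ℝ}
    (hc : |c| < 5 / 4) :
    HasDerivAt (fun c => ∫ x, F x * heat g (√2 * c) x)
      (2 * c * ∫ x, F x * lap (heat g (√2 * c)) x) c := by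
  have h2 : √2 * √2 = 2 := Real.mul_self_sqrt (by norm_num)
  have hlap : ∀ c, lap (heat g c) = heat (lap g) c := fun c => by
    funext x
    rw [heat_lap hg]
    exact Finset.sum_congr rfl fun i _ => by rw [← pd_heat (hg.pd i), ← pd_heat hg]
  obtain ⟨D, hD, hD1⟩ := heat_decay hg.lap
  obtain ⟨B, hB⟩ := hF.dk.bc.2
  have hB0 : 0 ≤ B := (abs_nonneg _).trans (hB 0)
  have hs2 : √2 ≤ 3 / 2 := by rw [Real.sqrt_le_left (by norm_num)]; norm_num
  have hc5 : ∀ c ∈ Icc (-5 / 4 : ℝ) (5 / 4), |c| ≤ 5 / 4 := fun c hc =>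
    abs_le.2 ⟨by linarith [hc.1], hc.2⟩
  have hab : ∀ c ∈ Icc (-5 / 4 : ℝ) (5 / 4), |√2 * c| ≤ 2 := fun c hc => by
    rw [abs_mul, abs_of_nonneg (Real.sqrt_nonneg _)]
    nlinarith [hc5 c hc, abs_nonneg c, Real.sqrt_nonneg 2]
  rw [← integral_const_mul]
  refine hasDerivAt_integral_of_le_wt (C := 3 * (B * D)) (s := Icc (-5 / 4) (5 / 4))
    (a' := fun c x => 2 * c * (F x * lap (heat g (√2 * c)) x))
    (Icc_mem_nhds (by linarith [(abs_lt.1 hc).1]) (abs_lt.1 hc).2)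
    (fun c x => ?_) (fun c => ?_) ?_ ?_ (fun c hc x => ?_)
  · have h1 := ((hasDerivAt_heat hg (√2 * c) x).comp c
      ((hasDerivAt_id c).const_mul √2)).const_mul (F x)
    refine h1.congr_deriv ?_
    rw [hlap]
    linear_combination (c * F x * heat (lap g) (√2 * c) x) * h2
  · exact hF.1.continuous.mul (contDiff_heat hg _).continuous
  · rw [hlap]
    exact continuous_const.mul (hF.1.continuous.mul (contDiff_heat hg.lap _).continuous)
  · exact (hF.mul (contDiff_heat hg _)).dk.integrable
  · rw [hlap, abs_mul, abs_mul, abs_mul, abs_two]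
    have q1 := mul_le_mul (hB x) (hD1 _ (hab c hc) x) (abs_nonneg _) hB0
    have q2 : 2 * |c| ≤ 3 := by linarith [hc5 c hc]
    calc _ ≤ 3 * (B * (D * wt x)) := mul_le_mul q2 q1 (by positivity) (by norm_num)
      _ = _ := by ring

/-- A duality form of the Calderón–Zygmund estimate for the pressure, localized. -/
lemma exists_integral_pressure_mul_le : ∃ C, 0 ≤ C ∧ ∀ (P g : E3 → ℝ) (u : Fin 3 → E3 → ℝ),
    TF P → (∀ i, TF (u i)) → TF g → (∀ y, g y ≠ 0 → ‖y‖ ≤ 1 / 4) →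
    (∀ x, ‖x‖ < 3 / 4 → lap P x = -∑ i, ∑ j, pd (pd (fun y => u i y * u j y) j) i x) →
    ∫ x, P x * g x ≤ C * ((∫ x, |g x| ^ 3) + ∫ x, √(∑ i, u i x ^ 2) ^ 3)
      + C * (∫ x, |g x|) * ((∫ x, |P x|) + ∫ x, ∑ i, u i x ^ 2) := by
  obtain ⟨χ, hχ, hχ0, hχ1, hχin, hχout⟩ :=
    exists_bump (r := 1 / 2) (R := 3 / 4) (by norm_num) (by norm_num)
  obtain ⟨K, hK, hheat⟩ := exists_heat_bound
  have hb : ∀ i, ∃ B, ∀ x, |pd χ i x| ≤ B := fun i => (hχ.pd i).dk.bc.2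
  have hb2 : ∀ i j, ∃ B, ∀ x, |pd (pd χ i) j x| ≤ B := fun i j => ((hχ.pd i).pd j).dk.bc.2
  choose B1 hB1 using hb
  choose B2 hB2 using hb2
  set S := ∑ i, ∑ j, (|B1 i| + |B2 i j|) with hS
  have hS0 : 0 ≤ S := by positivity
  have hSij : ∀ i j, |B1 i| + |B2 i j| ≤ S := fun i j =>
    (Finset.single_le_sum (f := fun j => |B1 i| + |B2 i j|) (fun j _ => by positivity)
      (Finset.mem_univ j)).trans
    (Finset.single_le_sum (f := fun i => ∑ j, (|B1 i| + |B2 i j|)) (fun i _ => by positivity)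
      (Finset.mem_univ i))
  have hS1 : ∀ i x, |pd χ i x| ≤ S := fun i x =>
    (hB1 i x).trans ((le_abs_self _).trans (le_trans (by linarith [abs_nonneg (B2 i 0)])
      (hSij i 0)))
  have hS2 : ∀ i j x, |pd (pd χ i) j x| ≤ S := fun i j x =>
    (hB2 i j x).trans ((le_abs_self _).trans (le_trans (by linarith [abs_nonneg (B1 i)])
      (hSij i j)))
  have hz : ∀ i x, ‖x‖ < 1 / 2 → pd χ i =ᶠ[nhds x] fun _ => 0 := fun i x hx => by
    have h1 : χ =ᶠ[nhds x] fun _ => 1 := by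
      filter_upwards [continuous_norm.continuousAt.eventually_lt_const hx] with y hy
      exact hχin y hy.le
    have := pd_eventuallyEq h1 i
    simpa only [funext (pd_const 1 i)] using this
  have hz1 : ∀ i x, ‖x‖ < 1 / 2 → pd χ i x = 0 := fun i x hx => (hz i x hx).eq_of_nhds
  have hz2 : ∀ i j x, ‖x‖ < 1 / 2 → pd (pd χ i) j x = 0 := fun i j x hx => by
    have := (pd_eventuallyEq (hz i x hx) j).eq_of_nhds
    rwa [pd_const] at this
  refine ⟨400 + 9 * (S * K) + K, by positivity, fun P g u hP hu hg hgs heq => ?_⟩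
  obtain ⟨hf0, hf1, hf2⟩ := hheat g hg hgs
  set G := ∫ x, |g x| with hG
  have hG0 : 0 ≤ G := integral_nonneg fun x => abs_nonneg _
  set N := (∫ x, |P x|) + ∫ x, ∑ i, u i x ^ 2 with hN
  have hNP : ∫ x, |P x| ≤ N := by
    have : 0 ≤ ∫ x, ∑ i, u i x ^ 2 := integral_nonneg fun x => by positivity
    linarith
  have hP0 : 0 ≤ ∫ x, |P x| := integral_nonneg fun x => abs_nonneg _
  have hN0 : 0 ≤ N := hP0.trans hNP
  have hs : TF (fun x => χ x * ∑ i, u i x ^ 2) :=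
    hχ.mul (ContDiff.sum fun i _ => (hu i).1.pow 2)
  have hχu : ∀ i j, TF (fun x => χ x * (u i x * u j x)) := fun i j =>
    hχ.mul ((hu i).1.mul (hu j).1)
  set Φ : Fin 3 → Fin 3 → E3 → ℝ := fun i j x =>
    χ x * (u i x * u j x) + χ x * ∑ k, u k x ^ 2 with hΦdef
  set Ψ : E3 → ℝ := fun x => χ x * ∑ k, u k x ^ 2 with hΨdef
  have hΦ : ∀ i j, TF (Φ i j) := fun i j => (hχu i j).add hs
  have hss0 : ∀ x, 0 ≤ ∑ k, u k x ^ 2 := fun x => by positivity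
  have hΨ0 : ∀ x, 0 ≤ Ψ x := fun x => mul_nonneg (hχ0 x) (hss0 x)
  have hΦ0 : ∀ i j x, 0 ≤ Φ i j x := fun i j x => by
    simp only [hΦdef]
    rw [← mul_add]
    refine mul_nonneg (hχ0 x) ?_
    linarith [(abs_le.1 (abs_mul_le_sum_sq (fun k => u k x) i j)).1]
  have hΦ2 : ∀ i j x, Φ i j x ≤ 2 * ∑ k, u k x ^ 2 := fun i j x => by
    simp only [hΦdef]
    rw [← mul_add]
    have h1 := (abs_le.1 (abs_mul_le_sum_sq (fun k => u k x) i j)).2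
    have h2 := (abs_le.1 (abs_mul_le_sum_sq (fun k => u k x) i j)).1
    refine (mul_le_of_le_one_left ?_ (hχ1 x)).trans ?_ <;> linarith
  have hΨ2 : ∀ x, Ψ x ≤ 2 * ∑ k, u k x ^ 2 := fun x => by
    have := mul_le_of_le_one_left (hss0 x) (hχ1 x)
    linarith [hss0 x]
  have hFF : TF (fun x => χ x * P x) := hχ.mul hP.1
  have key : ∀ c ∈ Ioo (0 : ℝ) 1,
      |(∫ x, χ x * P x * lap (heat g (√2 * c)) x)
      + ∑ i, ∑ j, ∫ x, χ x * (u i x * u j x) * pd (pd (heat g (√2 * c)) i) j x|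
      ≤ 9 * (S * (K * G)) * N := fun c hc => by
    have hcp : 0 < √2 * c := mul_pos (by positivity) hc.1
    have hSK : 0 ≤ S * (K * G) := by positivity
    refine abs_weak_form_le hχ (contDiff_heat hg _) hP hu (fun x hx => heq x ?_)
      (fun x i j => ?_) (fun x i j => ?_)
    · by_contra h
      exact hx (hχout x (not_lt.1 h))
    · by_cases hx : ‖x‖ < 1 / 2
      · rw [hz1 i x hx, zero_mul, abs_zero]; exact hSK
      · rw [abs_mul, pd_heat hg]
        exact mul_le_mul (hS1 i x) (hf1 _ x j hcp (not_lt.1 hx)) (abs_nonneg _) hS0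
    · by_cases hx : ‖x‖ < 1 / 2
      · rw [hz2 i j x hx, zero_mul, abs_zero]; exact hSK
      · rw [abs_mul]
        exact mul_le_mul (hS2 i j x) (hf0 _ x hcp (not_lt.1 hx)) (abs_nonneg _) hS0
  set L := 9 * (S * (K * G)) * N with hL
  have hsqrt : ∀ e > 0, ∫ x, P x * g x ≤
      (2 * ∑ i, ∑ j, (energy g (Φ i j) e 0 + energy g Ψ e 0)) + L + K * G * N := fun e he => by
    have hex : ∀ (f : E3 → ℝ), TF f → (∀ x, 0 ≤ f x) → ∀ c, ∃ d, (0 ≤ c → c < 2 →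
        HasDerivAt (energy g f e) d c ∧ ∀ i j,
          c * |∫ x, heat (pd f i) c x * heat (pd g j) c x| ≤ -d) := fun f hf hf0 c => by
      by_cases h : 0 ≤ c ∧ c < 2
      · obtain ⟨d, hd⟩ := energy_deriv hg hf hf0 he h.1 h.2
        exact ⟨d, fun _ _ => hd⟩
      · exact ⟨0, fun h1 h2 => absurd ⟨h1, h2⟩ h⟩
    choose d hd using fun i j => hex (Φ i j) (hΦ i j) (hΦ0 i j)
    choose d0 hd0 using hex Ψ hs hΨ0
    set T : ℝ → ℝ := fun c => (∫ x, χ x * P x * heat g (√2 * c) x)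
      - 2 * (∑ i, ∑ j, (energy g (Φ i j) e c + energy g Ψ e c)) + L * c ^ 2 with hT
    have hEd : ∀ c, 0 ≤ c → c < 2 → HasDerivAt
        (fun c => ∑ i, ∑ j, (energy g (Φ i j) e c + energy g Ψ e c))
        (∑ i, ∑ j, (d i j c + d0 c)) c := fun c h0 h1 => by
      refine HasDerivAt.fun_sum fun i _ => HasDerivAt.fun_sum fun j _ => ?_
      exact (hd i j c h0 h1).1.add (hd0 c h0 h1).1
    have hTd : ∀ c ∈ Ioo (0 : ℝ) 1, HasDerivAt T
        (2 * c * (∫ x, χ x * P x * lap (heat g (√2 * c)) x)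
          - 2 * (∑ i, ∑ j, (d i j c + d0 c)) + L * (2 * c)) c := fun c hc => by
      have h1 := hasDerivAt_integral_heat_sqrt_two hFF hg
          (by rw [abs_of_pos hc.1]; linarith [hc.2])
      have h2 := (hEd c hc.1.le (by linarith [hc.2])).const_mul 2
      have h3 := (hasDerivAt_pow 2 c).const_mul L
      exact ((h1.sub h2).add h3).congr_deriv (by norm_num)
    have hmono : MonotoneOn T (Icc 0 1) := by
      refine monotoneOn_of_deriv_nonneg (convex_Icc 0 1) ?_ ?_ ?_
      · refine (ContinuousOn.sub ?_ (ContinuousOn.mul continuousOn_const ?_)).add (by fun_prop)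
        · exact fun c hc => (hasDerivAt_integral_heat_sqrt_two hFF hg
            (by rw [abs_of_nonneg hc.1]; linarith [hc.2])).continuousAt.continuousWithinAt
        exact fun c hc => (hEd c hc.1 (by linarith [hc.2])).continuousAt.continuousWithinAt
      · rw [interior_Icc]
        exact fun c hc => (hTd c hc).differentiableAt.differentiableWithinAt
      · rw [interior_Icc]
        intro c hc
        rw [(hTd c hc).deriv]
        have hca : |c| ≤ 1 := by rw [abs_of_pos hc.1]; exact hc.2.le
        have hij : ∀ i j, c * (∫ x, χ x * (u i x * u j x) * pd (pd (heat g (√2 * c)) i) j x)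
            ≤ -(d i j c + d0 c) := fun i j => by
          have p : pd (pd (heat g (√2 * c)) i) j = heat (pd (pd g i) j) (√2 * c) := by
            rw [pd_heat hg, pd_heat (hg.pd i)]
          have hsp : ∫ x, χ x * (u i x * u j x) * pd (pd (heat g (√2 * c)) i) j x
              = (∫ x, Φ i j x * heat (pd (pd g i) j) (√2 * c) x)
                - ∫ x, Ψ x * heat (pd (pd g i) j) (√2 * c) x := by
            rw [p, ← integral_sub]
            · refine integral_congr_ae (Filter.Eventually.of_forall fun x => ?_)
              simp only [hΦdef, hΨdef]
              ring
            · exact ((hΦ i j).mul (contDiff_heat ((hg.pd i).pd j) _)).dk.integrable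
            · exact (hs.mul (contDiff_heat ((hg.pd i).pd j) _)).dk.integrable
          rw [hsp, integral_mul_heat_pd_pd (hΦ i j) hg hca, integral_mul_heat_pd_pd hs hg hca]
          have r1 := (hd i j c hc.1.le (by linarith [hc.2])).2 j i
          have r2 := (hd0 c hc.1.le (by linarith [hc.2])).2 j i
          have r3 := mul_le_mul_of_nonneg_left
            (neg_le_abs (∫ x, heat (pd (Φ i j) j) c x * heat (pd g i) c x)) hc.1.le
          have r4 := mul_le_mul_of_nonneg_left
            (le_abs_self (∫ x, heat (pd Ψ j) c x * heat (pd g i) c x)) hc.1.le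
          linarith
        have hsum := Finset.sum_le_sum fun i (_ : i ∈ Finset.univ) =>
          Finset.sum_le_sum fun j (_ : j ∈ Finset.univ) => hij i j
        simp only [← Finset.mul_sum, Finset.sum_neg_distrib] at hsum
        have hk := mul_le_mul_of_nonneg_left (abs_le.1 (key c hc)).1 hc.1.le
        linarith
    have hT01 := hmono (left_mem_Icc.2 zero_le_one) (right_mem_Icc.2 zero_le_one) zero_le_one
    simp only [hT, mul_zero, heat_zero, mul_one] at hT01
    have hF0 : ∫ x, χ x * P x * g x = ∫ x, P x * g x := by
      refine integral_congr_ae (Filter.Eventually.of_forall fun x => ?_)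
      by_cases hx : g x = 0
      · simp [hx]
      · simp only [hχin x ((hgs x hx).trans (by norm_num)), one_mul]
    have hE1 : 0 ≤ ∑ i, ∑ j, (energy g (Φ i j) e 1 + energy g Ψ e 1) :=
      Finset.sum_nonneg fun i _ => Finset.sum_nonneg fun j _ =>
        add_nonneg (energy_nonneg (hΦ0 i j) he 1) (energy_nonneg hΨ0 he 1)
    have hF1 : ∫ x, χ x * P x * heat g √2 x ≤ K * G * N := by
      have h1 : (1 : ℝ) ≤ √2 := Real.le_sqrt_of_sq_le (by norm_num)
      have : |∫ x, χ x * P x * heat g √2 x| ≤ ∫ x, |P x| * (K * G) := by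
        rw [← Real.norm_eq_abs]
        refine norm_integral_le_of_norm_le (hP.dk.integrable.abs.mul_const _)
          (Filter.Eventually.of_forall fun x => ?_)
        rw [Real.norm_eq_abs, abs_mul, abs_mul, abs_of_nonneg (hχ0 x)]
        exact mul_le_mul (mul_le_of_le_one_left (abs_nonneg _) (hχ1 x)) (hf2 _ x h1)
          (abs_nonneg _) (abs_nonneg _)
      rw [integral_mul_const] at this
      have h3 := mul_le_mul_of_nonneg_right hNP (by positivity : 0 ≤ K * G)
      linarith [le_abs_self (∫ x, χ x * P x * heat g √2 x)]
    rw [hF0] at hT01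
    linarith
  set I3 := ∫ x, |g x| ^ 3 with hI3
  set U3 := ∫ x, √(∑ i, u i x ^ 2) ^ 3 with hU3
  have hU0 : 0 ≤ U3 := integral_nonneg fun x => by positivity
  have hI0 : 0 ≤ I3 := integral_nonneg fun x => by positivity
  have hU3i : Integrable (fun x => √(∑ i, u i x ^ 2) ^ 3) := by
    have h1 : TF (fun x => ∑ i, u i x * u i x) := TF.sum _ fun i _ => (hu i).mul (hu i).1
    simp only [sq (u _ _)]
    exact h1.integrable_comp (φ := fun t => √t ^ 3) (by fun_prop) (by simp)
  have hcube : ∀ f : E3 → ℝ, (∀ x, f x ≤ 2 * ∑ k, u k x ^ 2) → ∫ x, √(f x) ^ 3 ≤ 4 * U3 :=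
    fun f hf => by
      rw [hU3, ← integral_const_mul]
      exact integral_mono_of_nonneg (Filter.Eventually.of_forall fun x => by positivity)
        (hU3i.const_mul 4) (Filter.Eventually.of_forall fun x => sqrt_cube_le (hf x))
  have hfin : ∫ x, P x * g x ≤ 400 * (I3 + U3) + L + K * G * N := by
    refine le_of_forall_le_add_mul (k := 2 * ∑ i, ∑ j,
      (2 * ((∫ x, g x ^ 2) + ∫ x, Φ i j x) + 2 * ((∫ x, g x ^ 2) + ∫ x, Ψ x))) fun e he => ?_
    have hE : ∀ i j, energy g (Φ i j) e 0 + energy g Ψ e 0 ≤ 16 * (I3 + U3)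
        + e * (2 * ((∫ x, g x ^ 2) + ∫ x, Φ i j x) + 2 * ((∫ x, g x ^ 2) + ∫ x, Ψ x)) :=
      fun i j => by
        have h1 := energy_zero_le hg (hΦ i j) (hΦ0 i j) he
        have h2 := energy_zero_le hg hs hΨ0 he
        have h3 := hcube _ (hΦ2 i j)
        have h4 := hcube _ hΨ2
        linarith
    have hsum := Finset.sum_le_sum fun i (_ : i ∈ Finset.univ) =>
          Finset.sum_le_sum fun j (_ : j ∈ Finset.univ) => hE i j
    simp only [Finset.sum_add_distrib, ← Finset.mul_sum, Finset.sum_const, Finset.card_univ,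
      Fintype.card_fin, nsmul_eq_mul] at hsum ⊢
    have := hsqrt e he
    simp only [Finset.sum_add_distrib, ← Finset.mul_sum, Finset.sum_const, Finset.card_univ,
      Fintype.card_fin, nsmul_eq_mul] at this
    push_cast at hsum this ⊢
    linarith
  refine hfin.trans ?_
  have h1 : 0 ≤ (9 * (S * K) + K) * (I3 + U3) := by positivity
  have h2 : 0 ≤ 400 * G * N := by positivity
  linarith

lemma mul_sq_le_cube_add_cube {a s : ℝ} (ha : 0 ≤ a) (hs : 0 ≤ s) : a * s ^ 2 ≤ a ^ 3 + s ^ 3 := by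
  rcases le_total a s with h | h
  · nlinarith [mul_le_mul_of_nonneg_right h (sq_nonneg s), pow_nonneg ha 3]
  · nlinarith [mul_le_mul h h hs ha, pow_nonneg hs 3]

lemma integral_mul_sq_le {f : E3 → ℝ} (hf : Integrable (fun x => |f x|))
    (hf3 : Integrable (fun x => |f x| ^ 3)) {R : ℝ} (hs : ∀ x, R ≤ ‖x‖ → f x = 0) {a : ℝ}
    (ha : 0 ≤ a) :
    (∫ x, |f x|) * a ^ 2
      ≤ (∫ x, |f x| ^ 3) + volume.real (Metric.ball (0 : E3) R) * a ^ 3 := by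
  have h1 : Integrable ((Metric.ball (0 : E3) R).indicator fun _ => a ^ 3) :=
    (integrable_indicator_iff measurableSet_ball).2 (integrableOn_const measure_ball_lt_top.ne)
  have h2 : ∫ x, (Metric.ball (0 : E3) R).indicator (fun _ => a ^ 3) x
      = volume.real (Metric.ball (0 : E3) R) * a ^ 3 := by
    rw [integral_indicator measurableSet_ball, setIntegral_const, smul_eq_mul]
  rw [← h2, ← integral_mul_const, ← integral_add hf3 h1]
  refine integral_mono (hf.mul_const _) (hf3.add h1) fun x => ?_
  by_cases hx : ‖x‖ < R
  · have hm : x ∈ Metric.ball (0 : E3) R := by simpa using hx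
    simp only [indicator_of_mem hm]
    exact mul_sq_le_cube_add_cube (abs_nonneg _) ha
  · simp only [hs x (not_lt.1 hx), abs_zero, zero_mul]
    refine add_nonneg (by positivity) (indicator_nonneg (fun _ _ => by positivity) _)

lemma integral_mul_integral_sq_le {g s : E3 → ℝ} (hg : TF g) {r : ℝ}
    (hgs : ∀ x, r ≤ ‖x‖ → g x = 0) (hs0 : ∀ x, 0 ≤ s x) (hs1 : ∀ x, 1 ≤ ‖x‖ → s x = 0)
    (hs2 : Integrable (fun x => s x ^ 2)) (hs3 : Integrable (fun x => s x ^ 3)) :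
    (∫ x, |g x|) * ∫ x, s x ^ 2
      ≤ volume.real (Metric.ball (0 : E3) 1) * (∫ x, |g x| ^ 3)
        + volume.real (Metric.ball (0 : E3) r) * ∫ x, s x ^ 3 := by
  have i1 : Integrable (fun x => |g x|) := hg.dk.integrable.abs
  have i3 : Integrable (fun x => |g x| ^ 3) :=
    hg.integrable_comp (φ := fun t => |t| ^ 3) (by fun_prop) (by simp)
  have h0 : 0 ≤ ∫ x, |g x| ^ 3 := integral_nonneg fun x => by positivity
  have h1 : Integrable ((Metric.ball (0 : E3) 1).indicator fun _ => ∫ x, |g x| ^ 3) :=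
    (integrable_indicator_iff measurableSet_ball).2 (integrableOn_const measure_ball_lt_top.ne)
  have h2 : ∫ x, (Metric.ball (0 : E3) 1).indicator (fun _ => ∫ x, |g x| ^ 3) x
      = volume.real (Metric.ball (0 : E3) 1) * ∫ x, |g x| ^ 3 := by
    rw [integral_indicator measurableSet_ball, setIntegral_const, smul_eq_mul]
  rw [← h2, ← integral_const_mul, ← integral_const_mul, ← integral_add h1 (hs3.const_mul _)]
  refine integral_mono (hs2.const_mul _) (h1.add (hs3.const_mul _)) fun x => ?_
  by_cases hx : ‖x‖ < 1
  · have hm : x ∈ Metric.ball (0 : E3) 1 := by simpa using hx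
    simp only [indicator_of_mem hm]
    exact integral_mul_sq_le i1 i3 hgs (hs0 x)
  · simp only [hs1 x (not_lt.1 hx)]
    have := indicator_nonneg (s := Metric.ball (0 : E3) 1) (f := fun _ => ∫ x, |g x| ^ 3)
      (fun _ _ => h0) x
    simpa using this

lemma volume_real_ball_two_mul {r : ℝ} (hr : 0 < r) :
    volume.real (Metric.ball (0 : E3) (2 * r))
      = 8 * r ^ 3 * volume.real (Metric.ball (0 : E3) 1) := by
  rw [Measure.real, Measure.addHaar_ball_of_pos _ _ (by positivity), ENNReal.toReal_mul,
    ENNReal.toReal_ofReal (by positivity), Measure.real]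
  have : Module.finrank ℝ E3 = 3 := by simp [E3]
  rw [this]
  ring

/-- The regularized test function: pointwise inequalities. -/
lemma regularized_root {p e : ℝ} (he : 0 < e) :
    0 < √√(p ^ 2 + e ^ 4) ∧ (|p| / √√(p ^ 2 + e ^ 4)) ^ 3 ≤ p ^ 2 / √√(p ^ 2 + e ^ 4) ∧
    √|p| ^ 3 ≤ p ^ 2 / √√(p ^ 2 + e ^ 4) + e * |p| := by
  have hpos : 0 < p ^ 2 + e ^ 4 := by positivity
  set q := √√(p ^ 2 + e ^ 4) with hq
  have hq0 : 0 < q := Real.sqrt_pos.2 (Real.sqrt_pos.2 hpos)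
  have hq2 : q ^ 2 = √(p ^ 2 + e ^ 4) := Real.sq_sqrt (Real.sqrt_nonneg _)
  have hpq : |p| ≤ q ^ 2 := by
    rw [hq2]; exact Real.abs_le_sqrt (by linarith [pow_pos he 4])
  refine ⟨hq0, ?_, ?_⟩
  · rw [div_pow, div_le_div_iff₀ (by positivity) hq0, ← sq_abs p]
    have : |p| ^ 3 * q = |p| ^ 2 * |p| * q := by ring
    rw [this]
    have h2 := mul_le_mul_of_nonneg_left hpq (by positivity : 0 ≤ |p| ^ 2 * q)
    linarith
  · have hs0 := Real.sqrt_nonneg |p|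
    have hs2 := Real.sq_sqrt (abs_nonneg p)
    set s := √|p| with hs
    have hqs : q ≤ s + e := by
      refine Real.sqrt_le_iff.2 ⟨by positivity, Real.sqrt_le_iff.2 ⟨by positivity, ?_⟩⟩
      rw [← sq_abs p, ← hs2]
      have : ((s + e) ^ 2) ^ 2 = (s ^ 2) ^ 2 + e ^ 4
        + (4 * s ^ 3 * e + 6 * s ^ 2 * e ^ 2 + 4 * s * e ^ 3) := by ring
      rw [this]
      linarith [show 0 ≤ 4 * s ^ 3 * e + 6 * s ^ 2 * e ^ 2 + 4 * s * e ^ 3 by positivity]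
    have h1 : s ^ 4 / (s + e) ≤ p ^ 2 / q := by
      rw [← sq_abs p, ← hs2, ← pow_mul]
      exact div_le_div_of_nonneg_left (by positivity) hq0 hqs
    have h2 : s ^ 3 - e * s ^ 2 ≤ s ^ 4 / (s + e) := by
      rw [le_div_iff₀ (by positivity)]
      nlinarith [mul_nonneg (sq_nonneg e) (sq_nonneg s)]
    rw [← hs2]
    linarith

/-- Interior decay estimate for a compactly supported pressure. -/
lemma exists_pressure_decay : ∃ C, 0 ≤ C ∧ ∀ (P : E3 → ℝ) (u : Fin 3 → E3 → ℝ),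
    TF P → (∀ i, TF (u i)) → (∀ x, 1 ≤ ‖x‖ → P x = 0) → (∀ i x, 1 ≤ ‖x‖ → u i x = 0) →
    (∀ x, ‖x‖ < 3 / 4 → lap P x = -∑ i, ∑ j, pd (pd (fun y => u i y * u j y) j) i x) →
    ∀ r, 0 < r → r ≤ 1 / 8 → ∫ x in Metric.ball 0 r, √|P x| ^ 3
      ≤ C * (r ^ 3 * (∫ x, √|P x| ^ 3) + ∫ x, √(∑ i, u i x ^ 2) ^ 3) := by
  obtain ⟨C, hC, hmain⟩ := exists_integral_pressure_mul_le
  set V := volume.real (Metric.ball (0 : E3) 1) with hV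
  have hV0 : 0 ≤ V := measureReal_nonneg
  set k := √(1 / (2 * (C * (1 + 2 * V) + 1))) with hk
  have hk0 : 0 < k := Real.sqrt_pos.2 (by positivity)
  have hk2 : C * (1 + 2 * V) * k ^ 2 ≤ 1 / 2 := by
    rw [hk, Real.sq_sqrt (by positivity), mul_one_div, div_le_iff₀ (by positivity)]
    linarith
  refine ⟨2 / k * (C * (1 + 8 * V)), by positivity, fun P u hP hu hP1 hu1 heq r hr hr8 => ?_⟩
  obtain ⟨η, hη, hη0, hη1, hηin, hηout⟩ := exists_bump (r := r) (R := 2 * r) hr (by linarith)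
  set Q := ∫ x, √|P x| ^ 3 with hQ
  set U3 := ∫ x, √(∑ i, u i x ^ 2) ^ 3 with hU3
  have hU0 : 0 ≤ U3 := integral_nonneg fun x => by positivity
  have hQ0 : 0 ≤ Q := integral_nonneg fun x => by positivity
  have hQi : Integrable (fun x => √|P x| ^ 3) :=
    hP.integrable_comp (φ := fun t => √|t| ^ 3) (by fun_prop) (by simp)
  have hPi : Integrable (fun x => √|P x| ^ 2) :=
    hP.integrable_comp (φ := fun t => √|t| ^ 2) (by fun_prop) (by simp)
  have huu : TF (fun x => ∑ i, u i x ^ 2) := by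
    simp only [sq (u _ _)]
    exact TF.sum _ fun i _ => (hu i).mul (hu i).1
  have hU3i : Integrable (fun x => √(∑ i, u i x ^ 2) ^ 3) :=
    huu.integrable_comp (φ := fun t => √t ^ 3) (by fun_prop) (by simp)
  have hU2i : Integrable (fun x => √(∑ i, u i x ^ 2) ^ 2) :=
    huu.integrable_comp (φ := fun t => √t ^ 2) (by fun_prop) (by simp)
  have hηQ : Integrable (fun x => η x * √|P x| ^ 3) :=
    (hη.1.continuous.mul (by have := hP.1.continuous; fun_prop)).integrable_of_hasCompactSupport
      hη.2.mul_right
  have hηP : Integrable (fun x => η x * |P x|) :=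
    (hη.1.continuous.mul hP.1.continuous.abs).integrable_of_hasCompactSupport hη.2.mul_right
  have hloc : ∫ x in Metric.ball 0 r, √|P x| ^ 3 ≤ ∫ x, η x * √|P x| ^ 3 := by
    rw [← integral_indicator measurableSet_ball]
    refine integral_mono (hQi.indicator measurableSet_ball) hηQ fun x => ?_
    by_cases hx : x ∈ Metric.ball (0 : E3) r
    · have hx' : ‖x‖ ≤ r := by simpa using (Metric.mem_ball.1 hx).le
      simp only [indicator_of_mem hx, hηin x hx', one_mul, le_refl]
    · rw [indicator_of_notMem hx]
      exact mul_nonneg (hη0 x) (by positivity)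
  refine hloc.trans (le_of_forall_le_add_mul (k := ∫ x, η x * |P x|) fun e he => ?_)
  set g : E3 → ℝ := fun x => k * (η x * (P x / √√(P x ^ 2 + e ^ 4))) with hgdef
  have hq : ContDiff ℝ (⊤ : ℕ∞) (fun x => P x / √√(P x ^ 2 + e ^ 4)) := by
    have h0 : ∀ x, P x ^ 2 + e ^ 4 ≠ 0 := fun x => by positivity
    refine hP.1.div ((((hP.1.pow 2).add contDiff_const).sqrt h0).sqrt fun x => ?_) fun x =>
      (regularized_root he).1.ne'
    exact (Real.sqrt_pos.2 (by positivity)).ne'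
  have hg : TF g := (hη.mul hq).const_mul k
  have hgs : ∀ x, 2 * r ≤ ‖x‖ → g x = 0 := fun x hx => by
    simp only [hgdef, hηout x hx, zero_mul, mul_zero]
  have hgs' : ∀ x, g x ≠ 0 → ‖x‖ ≤ 1 / 4 := fun x hx => by
    by_contra h
    exact hx (hgs x (by linarith [not_le.1 h]))
  have hPg : ∀ x, P x * g x = k * (η x * (P x ^ 2 / √√(P x ^ 2 + e ^ 4))) := fun x => by
    simp only [hgdef]; ring
  have hg3 : ∀ x, |g x| ^ 3 ≤ k ^ 2 * (P x * g x) := fun x => by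
    obtain ⟨h1, h2, -⟩ := regularized_root (p := P x) he
    rw [hPg]
    simp only [hgdef]
    rw [abs_mul, abs_mul, abs_div, abs_of_pos hk0, abs_of_pos h1, abs_of_nonneg (hη0 x)]
    have h3 : η x ^ 3 ≤ η x := pow_le_of_le_one (hη0 x) (hη1 x) (by norm_num)
    have h4 := mul_le_mul h3 h2 (by positivity) (hη0 x)
    have h5 := mul_le_mul_of_nonneg_left h4 (by positivity : 0 ≤ k ^ 3)
    linarith
  have hPgi : Integrable (fun x => P x * g x) := (hP.mul hg.1).dk.integrable
  have hI3 : ∫ x, |g x| ^ 3 ≤ k ^ 2 * ∫ x, P x * g x := by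
    rw [← integral_const_mul]
    exact integral_mono (hg.integrable_comp (φ := fun t => |t| ^ 3) (by fun_prop) (by simp))
      (hPgi.const_mul _) hg3
  have hm := hmain P g u hP hu hg hgs' heq
  have y1 := integral_mul_integral_sq_le hg hgs (s := fun x => √|P x|)
    (fun x => Real.sqrt_nonneg _) (fun x hx => by simp [hP1 x hx]) hPi hQi
  have y2 := integral_mul_integral_sq_le hg hgs (s := fun x => √(∑ i, u i x ^ 2))
    (fun x => Real.sqrt_nonneg _) (fun x hx => by simp [hu1 _ x hx]) hU2i hU3i
  simp only [Real.sq_sqrt (abs_nonneg _)] at y1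
  simp only [fun x => Real.sq_sqrt (show 0 ≤ ∑ i, u i x ^ 2 by positivity)] at y2
  rw [volume_real_ball_two_mul hr] at y1 y2
  set I := ∫ x, P x * g x with hI
  set J := ∫ x, |g x| ^ 3 with hJ
  have hI0 : 0 ≤ I := integral_nonneg fun x => by
    show 0 ≤ P x * g x
    rw [hPg]
    exact mul_nonneg hk0.le (mul_nonneg (hη0 x) (div_nonneg (sq_nonneg _) (Real.sqrt_nonneg _)))
  have hr3 : r ^ 3 ≤ 1 := pow_le_one₀ hr.le (by linarith)
  have hIle : I ≤ 2 * (C * (1 + 8 * V)) * (r ^ 3 * Q + U3) := by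
    have z1 := mul_le_mul_of_nonneg_left (add_le_add y1 y2) hC
    have z2 : C * (1 + 2 * V) * J ≤ C * (1 + 2 * V) * (k ^ 2 * I) :=
      mul_le_mul_of_nonneg_left hI3 (by positivity)
    have z3 := mul_le_mul_of_nonneg_right hk2 hI0
    have z4 : C * V * U3 * r ^ 3 ≤ C * V * U3 := mul_le_of_le_one_right (by positivity) hr3
    have z5 : 0 ≤ C * (r ^ 3 * Q) := by positivity
    linarith
  have hfin : ∫ x, η x * √|P x| ^ 3 ≤ k⁻¹ * I + e * ∫ x, η x * |P x| := by
    rw [hI, ← integral_const_mul, ← integral_const_mul,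
      ← integral_add (hPgi.const_mul _) (hηP.const_mul _)]
    refine integral_mono hηQ ((hPgi.const_mul _).add (hηP.const_mul _)) fun x => ?_
    have h3 := mul_le_mul_of_nonneg_left (regularized_root (p := P x) he).2.2 (hη0 x)
    simp only [hPg]
    rw [inv_mul_cancel_left₀ hk0.ne']
    linarith
  refine hfin.trans (add_le_add ?_ le_rfl)
  calc k⁻¹ * I ≤ k⁻¹ * (2 * (C * (1 + 8 * V)) * (r ^ 3 * Q + U3)) :=
        mul_le_mul_of_nonneg_left hIle (inv_pos.2 hk0).le
    _ = _ := by rw [div_eq_mul_inv]; ring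

lemma pd_comp_add_smul (f : E3 → ℝ) (x₀ : E3) (R : ℝ) (i : Fin 3) (y : E3) :
    pd (fun y => f (x₀ + R • y)) i y = R * pd f i (x₀ + R • y) := by
  have h1 := fderiv_comp_smul (𝕜 := ℝ) (f := fun z => f (x₀ + z)) (x := y) R
  rw [fderiv_comp_add_left] at h1
  simp only [pd, h1, _root_.smul_apply, smul_eq_mul]

lemma pd_const_mul (f : E3 → ℝ) (c : ℝ) (i : Fin 3) (y : E3) :
    pd (fun y => c * f y) i y = c * pd f i y := by
  have h1 := fderiv_const_smul_field (𝕜 := ℝ) (f := f) (R := ℝ) c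
  have h2 : (fun y => c * f y) = c • f := rfl
  simp only [pd, h2, h1, Pi.smul_apply, _root_.smul_apply, smul_eq_mul]

lemma pd_pd_comp_add_smul (f : E3 → ℝ) (x₀ : E3) (R : ℝ) (i j : Fin 3) (y : E3) :
    pd (pd (fun y => f (x₀ + R • y)) i) j y = R ^ 2 * pd (pd f i) j (x₀ + R • y) := by
  have h1 : pd (fun y => f (x₀ + R • y)) i = fun y => R * pd f i (x₀ + R • y) :=
    funext fun y => pd_comp_add_smul f x₀ R i y
  rw [h1, pd_const_mul, pd_comp_add_smul]
  ring

lemma setIntegral_ball_comp (f : E3 → ℝ) (x₀ : E3) {R : ℝ} (hR : 0 < R) (s : ℝ) :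
    ∫ y in Metric.ball 0 s, f (x₀ + R • y) = (R ^ 3)⁻¹ * ∫ x in Metric.ball x₀ (R * s), f x := by
  rw [← integral_indicator measurableSet_ball, ← integral_indicator measurableSet_ball]
  have h1 : ∀ y, (Metric.ball (0 : E3) s).indicator (fun y => f (x₀ + R • y)) y
      = (Metric.ball x₀ (R * s)).indicator f (x₀ + R • y) := fun y => by
    have : y ∈ Metric.ball (0 : E3) s ↔ x₀ + R • y ∈ Metric.ball x₀ (R * s) := by
      rw [mem_ball_zero_iff, Metric.mem_ball, dist_eq_norm, add_sub_cancel_left, norm_smul,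
        Real.norm_of_nonneg hR.le, mul_lt_mul_iff_right₀ hR]
    by_cases hy : y ∈ Metric.ball (0 : E3) s
    · rw [indicator_of_mem hy, indicator_of_mem (this.1 hy)]
    · rw [indicator_of_notMem hy, indicator_of_notMem (fun h => hy (this.2 h))]
  simp only [h1]
  rw [Measure.integral_comp_smul volume
    (fun y => (Metric.ball x₀ (R * s)).indicator f (x₀ + y)) R,
    integral_add_left_eq_self (fun y => (Metric.ball x₀ (R * s)).indicator f y) x₀]
  have : Module.finrank ℝ E3 = 3 := by simp [E3]
  rw [this, abs_of_pos (by positivity), smul_eq_mul]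

lemma TF.of_cutoff {χ f : E3 → ℝ} (hχ : TF χ) (hχ1 : ∀ x, 1 ≤ ‖x‖ → χ x = 0)
    (hf : ∀ x, ‖x‖ ≤ 1 → ContDiffAt ℝ (⊤ : ℕ∞) f x) : TF (fun x => χ x * f x) := by
  refine ⟨contDiff_iff_contDiffAt.2 fun x => ?_, hχ.2.mul_right⟩
  by_cases hx : ‖x‖ ≤ 1
  · exact hχ.1.contDiffAt.mul (hf x hx)
  · have : (fun x => χ x * f x) =ᶠ[nhds x] fun _ => 0 := by
      filter_upwards [continuous_norm.continuousAt.eventually_const_lt (not_le.1 hx)] with y hy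
      rw [hχ1 y hy.le, zero_mul]
    exact contDiffAt_const.congr_of_eventuallyEq this

lemma integral_le_setIntegral_ball {F f : E3 → ℝ} (hF0 : ∀ x, 0 ≤ F x) (hf0 : ∀ x, 0 ≤ f x)
    (hFf : ∀ x, F x ≤ f x) (hF1 : ∀ x, 1 ≤ ‖x‖ → F x = 0)
    (hf : ContinuousOn f (Metric.closedBall 0 1)) :
    ∫ x, F x ≤ ∫ x in Metric.ball 0 1, f x := by
  rw [← integral_indicator measurableSet_ball]
  have hi : IntegrableOn f (Metric.ball 0 1) :=
    (hf.integrableOn_compact (isCompact_closedBall 0 1)).mono_set Metric.ball_subset_closedBall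
  refine integral_mono_of_nonneg (Filter.Eventually.of_forall hF0)
    (hi.integrable_indicator measurableSet_ball) (Filter.Eventually.of_forall fun x => ?_)
  by_cases hx : ‖x‖ < 1
  · have hm : x ∈ Metric.ball (0 : E3) 1 := by simpa using hx
    simp only [indicator_of_mem hm]
    exact hFf x
  · simp only [hF1 x (not_lt.1 hx)]
    exact indicator_nonneg (fun x _ => hf0 x) x

lemma norm_eq_sqrt_sum_sq (x : E3) : ‖x‖ = √(∑ i, x i ^ 2) := by
  simp [EuclideanSpace.norm_eq]

/-- Interior pressure decay at a fixed time, on an arbitrary ball. -/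
lemma exists_local_pressure_decay : ∃ C, 0 ≤ C ∧ ∀ (P : E3 → ℝ) (u : E3 → E3) (x₀ : E3) (R : ℝ)
    (V : Set E3), 0 < R → IsOpen V → Metric.closedBall x₀ R ⊆ V →
    ContDiffOn ℝ (⊤ : ℕ∞) P V → ContDiffOn ℝ (⊤ : ℕ∞) u V →
    (∀ x ∈ V, lap P x = -∑ i, ∑ j, pd (pd (fun y => u y i * u y j) j) i x) →
    ∀ ρ, 0 < ρ → 8 * ρ ≤ R → ∫ x in Metric.ball x₀ ρ, √|P x| ^ 3
      ≤ C * ((ρ / R) ^ 3 * (∫ x in Metric.ball x₀ R, √|P x| ^ 3)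
        + ∫ x in Metric.ball x₀ R, ‖u x‖ ^ 3) := by
  obtain ⟨C, hC, hmain⟩ := exists_pressure_decay
  obtain ⟨χ, hχ, hχ0, hχ1, hχin, hχout⟩ :=
    exists_bump (r := 3 / 4) (R := 1) (by norm_num) (by norm_num)
  refine ⟨C, hC, fun P u x₀ R V hR hV hBV hP hu heq ρ hρ hρR => ?_⟩
  have hmem : ∀ y : E3, ‖y‖ ≤ 1 → x₀ + R • y ∈ V := fun y hy => hBV <| by
    rw [Metric.mem_closedBall, dist_eq_norm, add_sub_cancel_left, norm_smul,
      Real.norm_of_nonneg hR.le]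
    exact mul_le_of_le_one_right hR.le hy
  have haff : ContDiff ℝ (⊤ : ℕ∞) (fun y : E3 => x₀ + R • y) :=
    contDiff_const.add (contDiff_id.const_smul R)
  have hPd : ∀ y : E3, ‖y‖ ≤ 1 → ContDiffAt ℝ (⊤ : ℕ∞) (fun y => P (x₀ + R • y)) y := fun y hy =>
    (hP.contDiffAt (hV.mem_nhds (hmem y hy))).comp y haff.contDiffAt
  have hud' : ∀ y : E3, ‖y‖ ≤ 1 → ContDiffAt ℝ (⊤ : ℕ∞) (fun y => u (x₀ + R • y)) y :=
    fun y hy => (hu.contDiffAt (hV.mem_nhds (hmem y hy))).comp y haff.contDiffAt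
  have hud : ∀ i, ∀ y : E3, ‖y‖ ≤ 1 → ContDiffAt ℝ (⊤ : ℕ∞) (fun y => u (x₀ + R • y) i) y :=
    fun i y hy => contDiffAt_euclidean.1 (hud' y hy) i
  have hPT : TF (fun y => χ y * P (x₀ + R • y)) := hχ.of_cutoff hχout hPd
  have huT : ∀ i, TF (fun y => χ y * u (x₀ + R • y) i) := fun i => hχ.of_cutoff hχout (hud i)
  have hr8 : ρ / R ≤ 1 / 8 := by rw [div_le_div_iff₀ hR (by norm_num)]; linarith
  have hχev : ∀ y : E3, ‖y‖ < 3 / 4 → ∀ᶠ z in nhds y, χ z = 1 := fun y hy => by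
    filter_upwards [continuous_norm.continuousAt.eventually_lt_const hy] with z hz
    exact hχin z hz.le
  have heq' : ∀ y : E3, ‖y‖ < 3 / 4 → lap (fun y => χ y * P (x₀ + R • y)) y
      = -∑ i, ∑ j, pd (pd (fun y => χ y * u (x₀ + R • y) i * (χ y * u (x₀ + R • y) j)) j) i y := by
    intro y hy
    have e1 : (fun y => χ y * P (x₀ + R • y)) =ᶠ[nhds y] fun y => P (x₀ + R • y) := by
      filter_upwards [hχev y hy] with z hz
      rw [hz, one_mul]
    have e2 : ∀ i j, (fun y => χ y * u (x₀ + R • y) i * (χ y * u (x₀ + R • y) j))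
        =ᶠ[nhds y] fun y => (fun x => u x i * u x j) (x₀ + R • y) := fun i j => by
      filter_upwards [hχev y hy] with z hz
      rw [hz, one_mul, one_mul]
    have e3 : ∀ i, pd (pd (fun y => χ y * P (x₀ + R • y)) i) i y
        = R ^ 2 * pd (pd P i) i (x₀ + R • y) := fun i => by
      rw [(pd_eventuallyEq (pd_eventuallyEq e1 i) i).eq_of_nhds, pd_pd_comp_add_smul]
    have e4 : ∀ i j, pd (pd (fun y => χ y * u (x₀ + R • y) i * (χ y * u (x₀ + R • y) j)) j) i y
        = R ^ 2 * pd (pd (fun x => u x i * u x j) j) i (x₀ + R • y) := fun i j => by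
      rw [(pd_eventuallyEq (pd_eventuallyEq (e2 i j) j) i).eq_of_nhds]
      exact pd_pd_comp_add_smul (fun x => u x i * u x j) x₀ R j i y
    have e5 := heq _ (hmem y (by linarith))
    simp only [e4, ← Finset.mul_sum]
    have e6 : lap (fun y => χ y * P (x₀ + R • y)) y
        = ∑ i, pd (pd (fun y => χ y * P (x₀ + R • y)) i) i y := rfl
    have e7 : lap P (x₀ + R • y) = ∑ i, pd (pd P i) i (x₀ + R • y) := rfl
    rw [e6]
    simp only [e3, ← Finset.mul_sum]
    rw [← e7, e5, mul_neg]
  have key := hmain (fun y => χ y * P (x₀ + R • y)) (fun i y => χ y * u (x₀ + R • y) i) hPT huT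
    (fun x hx => by simp only [hχout x hx, zero_mul])
    (fun i x hx => by simp only [hχout x hx, zero_mul]) heq' (ρ / R) (by positivity) hr8
  have k1 : ∫ y in Metric.ball 0 (ρ / R), √|χ y * P (x₀ + R • y)| ^ 3
      = (R ^ 3)⁻¹ * ∫ x in Metric.ball x₀ ρ, √|P x| ^ 3 := by
    have := setIntegral_ball_comp (fun x => √|P x| ^ 3) x₀ hR (ρ / R)
    rw [mul_div_cancel₀ _ hR.ne'] at this
    rw [← this]
    refine setIntegral_congr_fun measurableSet_ball fun y hy => ?_
    have hy' : ‖y‖ < ρ / R := by simpa using hy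
    simp only [hχin y (by linarith), one_mul]
  have k2 : ∫ y, √|χ y * P (x₀ + R • y)| ^ 3
      ≤ (R ^ 3)⁻¹ * ∫ x in Metric.ball x₀ R, √|P x| ^ 3 := by
    have := setIntegral_ball_comp (fun x => √|P x| ^ 3) x₀ hR 1
    rw [mul_one] at this
    rw [← this]
    refine integral_le_setIntegral_ball (fun x => by positivity) (fun x => by positivity)
      (fun x => ?_) (fun x hx => by simp [hχout x hx]) fun y hy => ?_
    · refine pow_le_pow_left₀ (Real.sqrt_nonneg _) (Real.sqrt_le_sqrt ?_) 3
      rw [abs_mul, abs_of_nonneg (hχ0 x)]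
      exact mul_le_of_le_one_left (abs_nonneg _) (hχ1 x)
    · have := (hPd y (by simpa using hy)).continuousAt
      exact (this.abs.sqrt.pow 3).continuousWithinAt
  have k3 : ∫ y, √(∑ i, (χ y * u (x₀ + R • y) i) ^ 2) ^ 3
      ≤ (R ^ 3)⁻¹ * ∫ x in Metric.ball x₀ R, ‖u x‖ ^ 3 := by
    have := setIntegral_ball_comp (fun x => ‖u x‖ ^ 3) x₀ hR 1
    rw [mul_one] at this
    rw [← this]
    refine integral_le_setIntegral_ball (fun x => by positivity) (fun x => by positivity)
      (fun x => ?_) (fun x hx => by simp [hχout x hx]) fun y hy => ?_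
    · rw [norm_eq_sqrt_sum_sq]
      refine pow_le_pow_left₀ (Real.sqrt_nonneg _)
        (Real.sqrt_le_sqrt (Finset.sum_le_sum fun i _ => ?_)) 3
      rw [mul_pow]
      exact mul_le_of_le_one_left (sq_nonneg _) (pow_le_one₀ (hχ0 x) (hχ1 x))
    · have := (hud' y (by simpa using hy)).continuousAt
      exact (this.norm.pow 3).continuousWithinAt
  rw [k1] at key
  have hR3 : 0 < R ^ 3 := by positivity
  have z1 := key.trans (mul_le_mul_of_nonneg_left
    (add_le_add (mul_le_mul_of_nonneg_left k2 (by positivity : 0 ≤ (ρ / R) ^ 3)) k3) hC)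
  rw [inv_mul_le_iff₀ hR3] at z1
  refine z1.trans (le_of_eq ?_)
  field_simp

section DirectionalDerivatives

variable {W : Type*} [NormedAddCommGroup W] [NormedSpace ℝ W]

/-- Directional derivative of a scalar function on a normed space. -/
def dd (v : W) (f : W → ℝ) (z : W) : ℝ := fderiv ℝ f z v

lemma contDiffOn_dd {f : W → ℝ} {U : Set W} (hU : IsOpen U) (hf : ContDiffOn ℝ (⊤ : ℕ∞) f U)
    (v : W) : ContDiffOn ℝ (⊤ : ℕ∞) (dd v f) U :=
  (hf.fderiv_of_isOpen hU (by simp)).clm_apply contDiffOn_const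

lemma differentiableAt_of_contDiffOn {f : W → ℝ} {U : Set W} (hU : IsOpen U)
    (hf : ContDiffOn ℝ (⊤ : ℕ∞) f U) {z : W} (hz : z ∈ U) : DifferentiableAt ℝ f z :=
  (hf.contDiffAt (hU.mem_nhds hz)).differentiableAt (by simp)

lemma dd_comm {f : W → ℝ} {U : Set W} (hU : IsOpen U) (hf : ContDiffOn ℝ (⊤ : ℕ∞) f U)
    (v w : W) {z : W} (hz : z ∈ U) : dd v (dd w f) z = dd w (dd v f) z := by
  have h1 := hf.contDiffAt (hU.mem_nhds hz)
  have h2 : IsSymmSndFDerivAt ℝ f z := h1.isSymmSndFDerivAt (by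
    rw [minSmoothness_of_isRCLikeNormedField]
    exact WithTop.coe_le_coe.2 (le_top : (2 : ℕ∞) ≤ ⊤))
  have h3 : DifferentiableAt ℝ (fderiv ℝ f) z :=
    ((hf.fderiv_of_isOpen (m := (⊤ : ℕ∞)) hU (by simp)).contDiffAt
      (hU.mem_nhds hz)).differentiableAt (by simp)
  have h4 : ∀ a b : W, dd a (dd b f) z = fderiv ℝ (fderiv ℝ f) z a b := fun a b => by
    have : dd b f = fun y => fderiv ℝ f y b := rfl
    rw [dd, this, fderiv_clm_apply h3 (differentiableAt_const b)]
    simp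
  rw [h4, h4, h2.eq]

lemma dd_congr {f g : W → ℝ} {U : Set W} (hU : IsOpen U) (h : ∀ z ∈ U, f z = g z) (v : W)
    {z : W} (hz : z ∈ U) : dd v f z = dd v g z := by
  have : f =ᶠ[nhds z] g := by filter_upwards [hU.mem_nhds hz] with y hy using h y hy
  rw [dd, dd, this.fderiv_eq]

lemma dd_sum {ι : Type*} (s : Finset ι) {f : ι → W → ℝ} {z : W}
    (hf : ∀ i ∈ s, DifferentiableAt ℝ (f i) z) (v : W) :
    dd v (fun y => ∑ i ∈ s, f i y) z = ∑ i ∈ s, dd v (f i) z := by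
  simp only [dd, fderiv_fun_sum hf, _root_.sum_apply]

lemma dd_add {f g : W → ℝ} {z : W} (hf : DifferentiableAt ℝ f z) (hg : DifferentiableAt ℝ g z)
    (v : W) : dd v (fun y => f y + g y) z = dd v f z + dd v g z := by
  simp only [dd, fderiv_fun_add hf hg, _root_.add_apply]

lemma dd_neg (f : W → ℝ) (z : W) (v : W) : dd v (fun y => -f y) z = -dd v f z := by
  simp only [dd, fderiv_fun_neg, _root_.neg_apply]

lemma dd_mul {f g : W → ℝ} {z : W} (hf : DifferentiableAt ℝ f z) (hg : DifferentiableAt ℝ g z)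
    (v : W) : dd v (fun y => f y * g y) z = f z * dd v g z + g z * dd v f z := by
  simp only [dd, fderiv_fun_mul hf hg, _root_.add_apply, _root_.smul_apply, smul_eq_mul]

/-- Taking the divergence of the momentum equation yields the pressure equation. -/
lemma sum_dd_dd_pressure {U : Set W} (hU : IsOpen U) (e : Fin 3 → W) (τ : W)
    {u : Fin 3 → W → ℝ} {p : W → ℝ} (hu : ∀ i, ContDiffOn ℝ (⊤ : ℕ∞) (u i) U)
    (hp : ContDiffOn ℝ (⊤ : ℕ∞) p U)
    (hmom : ∀ z ∈ U, ∀ j, dd τ (u j) z + (∑ i, u i z * dd (e i) (u j) z)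
      - (∑ i, dd (e i) (dd (e i) (u j)) z) + dd (e j) p z = 0)
    (hdiv : ∀ z ∈ U, ∑ i, dd (e i) (u i) z = 0) {z : W} (hz : z ∈ U) :
    ∑ i, dd (e i) (dd (e i) p) z
      = -∑ i, ∑ j, dd (e i) (dd (e j) (fun y => u i y * u j y)) z := by
  have hdiff : ∀ {f : W → ℝ}, ContDiffOn ℝ (⊤ : ℕ∞) f U → ∀ {z}, z ∈ U → DifferentiableAt ℝ f z :=
    fun hf _ hz => differentiableAt_of_contDiffOn hU hf hz
  have hD : ∀ {f : W → ℝ}, ContDiffOn ℝ (⊤ : ℕ∞) f U → ∀ v, ContDiffOn ℝ (⊤ : ℕ∞) (dd v f) U :=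
    fun hf v => contDiffOn_dd hU hf v
  have hflux : ∀ i, ∀ y ∈ U, (∑ j, dd (e j) (fun y => u i y * u j y) y)
      = (∑ k, dd (e k) (dd (e k) (u i)) y) + -(dd τ (u i) y + dd (e i) p y) := by
    intro i y hy
    have h1 : ∀ j, dd (e j) (fun y => u i y * u j y) y
        = u i y * dd (e j) (u j) y + u j y * dd (e j) (u i) y := fun j =>
      dd_mul (hdiff (hu i) hy) (hdiff (hu j) hy) _
    simp only [h1, Finset.sum_add_distrib, ← Finset.mul_sum, hdiv y hy]
    linarith [hmom y hy i]
  have hsum : ∀ i, ∑ j, dd (e i) (dd (e j) (fun y => u i y * u j y)) z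
      = (∑ k, dd (e i) (dd (e k) (dd (e k) (u i))) z)
        + -(dd (e i) (dd τ (u i)) z + dd (e i) (dd (e i) p) z) := by
    intro i
    rw [← dd_sum Finset.univ (fun j _ => hdiff (hD ((hu i).mul (hu j)) _) hz),
      dd_congr hU (hflux i) _ hz,
      dd_add (DifferentiableAt.fun_sum fun k _ => hdiff (hD (hD (hu i) _) _) hz)
        ((hdiff (hD (hu i) _) hz).fun_add (hdiff (hD hp _) hz)).fun_neg,
      dd_sum Finset.univ (fun k _ => hdiff (hD (hD (hu i) _) _) hz), dd_neg,
      dd_add (hdiff (hD (hu i) _) hz) (hdiff (hD hp _) hz)]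
  have hdiv1 : ∀ v, ∀ y ∈ U, ∑ i, dd v (dd (e i) (u i)) y = 0 := fun v y hy => by
    rw [← dd_sum Finset.univ (fun j _ => hdiff (hD (hu j) _) hy), dd_congr hU hdiv _ hy]
    simp [dd]
  have htime : ∑ i, dd (e i) (dd τ (u i)) z = 0 := by
    rw [← hdiv1 τ z hz]
    exact Finset.sum_congr rfl fun i _ => dd_comm hU (hu i) _ _ hz
  have hlap : ∑ i, ∑ k, dd (e i) (dd (e k) (dd (e k) (u i))) z = 0 := by
    rw [Finset.sum_comm]
    refine Finset.sum_eq_zero fun k _ => ?_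
    have h1 : ∀ i, dd (e i) (dd (e k) (dd (e k) (u i))) z
        = dd (e k) (dd (e k) (dd (e i) (u i))) z := fun i => by
      rw [dd_comm hU (hD (hu i) _) _ _ hz]
      exact dd_congr hU (fun y hy => dd_comm hU (hu i) _ _ hy) _ hz
    simp only [h1]
    rw [← dd_sum Finset.univ (fun j _ => hdiff (hD (hD (hu j) _) _) hz),
      dd_congr hU (hdiv1 _) _ hz]
    simp [dd]
  simp only [hsum, Finset.sum_add_distrib, Finset.sum_neg_distrib, htime, hlap]
  ring

end DirectionalDerivatives

lemma pd_slice {f : E3 × ℝ → ℝ} {x : E3} {t : ℝ} (hf : DifferentiableAt ℝ f (x, t)) (i : Fin 3) :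
    pd (fun y => f (y, t)) i x = dd ((ee i, 0) : E3 × ℝ) f (x, t) := by
  have h1 : HasFDerivAt (fun y : E3 => (y, t)) (ContinuousLinearMap.inl ℝ E3 ℝ) x :=
    hasFDerivAt_prodMk_left x t
  have h2 := hf.hasFDerivAt.comp x h1
  have h3 : (fun y => f (y, t)) = f ∘ fun y : E3 => (y, t) := rfl
  rw [pd, h3, h2.fderiv]
  rfl

lemma pd_pd_slice {f : E3 × ℝ → ℝ} {U : Set (E3 × ℝ)} (hU : IsOpen U)
    (hf : ContDiffOn ℝ (⊤ : ℕ∞) f U) {x : E3} {t : ℝ} (hx : (x, t) ∈ U) (i j : Fin 3) :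
    pd (pd (fun y => f (y, t)) i) j x
      = dd ((ee j, 0) : E3 × ℝ) (dd ((ee i, 0) : E3 × ℝ) f) (x, t) := by
  have h1 : pd (fun y => f (y, t)) i =ᶠ[nhds x]
      fun y => dd ((ee i, 0) : E3 × ℝ) f (y, t) := by
    have h2 : ∀ᶠ y in nhds x, (y, t) ∈ U :=
      (Continuous.prodMk_left t).continuousAt.eventually (hU.mem_nhds hx)
    filter_upwards [h2] with y hy
    exact pd_slice (differentiableAt_of_contDiffOn hU hf hy) i
  rw [(pd_eventuallyEq h1 j).eq_of_nhds,
    pd_slice (differentiableAt_of_contDiffOn hU (contDiffOn_dd hU hf _) hx)]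

lemma deriv_slice {f : E3 × ℝ → ℝ} {x : E3} {t : ℝ} (hf : DifferentiableAt ℝ f (x, t)) :
    deriv (fun s => f (x, s)) t = dd ((0, 1) : E3 × ℝ) f (x, t) := by
  have h1 : HasFDerivAt (fun s : ℝ => (x, s)) (ContinuousLinearMap.inr ℝ E3 ℝ) t :=
    hasFDerivAt_prodMk_right x t
  have h2 := hf.hasFDerivAt.comp t h1
  have h3 : (fun s => f (x, s)) = f ∘ fun s : ℝ => (x, s) := rfl
  rw [h3, h2.hasDerivAt.deriv]
  rfl

/-- The pressure of a classical solution solves `-ΔΠ = ∂ᵢ∂ⱼ(uᵢuⱼ)` on every time slice. -/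
lemma IsNSQ1.lap_pressure {u : E3 → ℝ → E3} {P : E3 → ℝ → ℝ} {U : Set (E3 × ℝ)}
    (h : IsNSQ1 u P U) {x : E3} {t : ℝ} (hx : (x, t) ∈ U) :
    lap (fun y => P y t) x
      = -∑ i, ∑ j, pd (pd (fun y => u y t i * u y t j) j) i x := by
  have hU := h.open_U
  have hui : ∀ i, ContDiffOn ℝ (⊤ : ℕ∞) (fun z : E3 × ℝ => u z.1 z.2 i) U := fun i =>
    contDiffOn_euclidean.1 h.smooth_u i
  have hdu : ∀ i, ∀ {y s}, (y, s) ∈ U →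
      DifferentiableAt ℝ (fun z : E3 × ℝ => u z.1 z.2 i) (y, s) := fun i _ _ hy =>
    differentiableAt_of_contDiffOn hU (hui i) hy
  have key := sum_dd_dd_pressure hU (fun i => ((ee i, 0) : E3 × ℝ)) ((0, 1) : E3 × ℝ)
    (u := fun i z => u z.1 z.2 i) (p := fun z => P z.1 z.2) hui h.smooth_P
    (fun z hz j => by
      have e1 := h.momentum z.1 z.2 hz j
      have e2 : deriv (fun s => u z.1 s j) z.2 = _ := deriv_slice (hdu j hz)
      have e3 : ∀ i, pd (fun y => u y z.2 j) i z.1 = _ := fun i => pd_slice (hdu j hz) i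
      have e4 : lap (fun y => u y z.2 j) z.1 = ∑ i, _ :=
        Finset.sum_congr rfl fun i _ => pd_pd_slice hU (hui j) hz i i
      have e5 : pd (fun y => P y z.2) j z.1 = _ :=
        pd_slice (differentiableAt_of_contDiffOn hU h.smooth_P hz) j
      simp only [e2, e3, e4, e5] at e1
      exact e1)
    (fun z hz => (Finset.sum_congr rfl fun i _ => (pd_slice (hdu i hz) i).symm).trans
      (h.divfree z.1 z.2 hz)) hx
  have e6 : lap (fun y => P y t) x = ∑ i, _ :=
    Finset.sum_congr rfl fun i _ => pd_pd_slice hU h.smooth_P hx i i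
  have e7 : ∀ i j, pd (pd (fun y => u y t i * u y t j) j) i x = _ := fun i j =>
    pd_pd_slice hU ((hui i).mul (hui j)) hx j i
  simp only [e6, e7]
  exact key

lemma abs_rpow_three_halves (x : ℝ) : |x| ^ (3 / 2 : ℝ) = √|x| ^ 3 := by
  rw [Real.sqrt_eq_rpow, ← Real.rpow_mul_natCast (abs_nonneg x)]
  norm_num

lemma integrableOn_setIntegral_ball {F : E3 × ℝ → ℝ} {x₀ : E3} {R a b : ℝ}
    (hF : ContinuousOn F (Metric.closedBall x₀ R ×ˢ Icc a b)) :
    IntegrableOn (fun t => ∫ x in Metric.ball x₀ R, F (x, t)) (Ioo a b) := by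
  have h1 : IntegrableOn F (Metric.ball x₀ R ×ˢ Ioo a b) :=
    (hF.integrableOn_compact ((isCompact_closedBall x₀ R).prod isCompact_Icc)).mono_set
      (prod_mono Metric.ball_subset_closedBall Ioo_subset_Icc_self)
  rw [IntegrableOn, Measure.volume_eq_prod, ← Measure.prod_restrict] at h1
  exact h1.integral_prod_right

lemma closedBall_prod_Icc_subset_closure_Qyl {z₀ : E3 × ℝ} (hz : z₀ ∈ Qyl (0, 0) (1 / 8)) {R : ℝ}
    (hR0 : 0 ≤ R) (hR : R ≤ 1 / 4) :
    Metric.closedBall z₀.1 R ×ˢ Icc (z₀.2 - R ^ 2) z₀.2 ⊆ closure (Qyl (0, 0) 1) := by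
  have h1 : ‖z₀.1‖ < 1 / 8 := by simpa using hz.1
  have h2 := hz.2
  simp only [mem_Ioo] at h2
  rw [Qyl, closure_prod_eq, closure_ball _ one_ne_zero, closure_Ioo (by norm_num)]
  refine prod_mono (Metric.closedBall_subset_closedBall' ?_) (Icc_subset_Icc ?_ h2.2.le)
  · simp only [dist_zero_right]
    linarith
  · simp only
    nlinarith

lemma integral_cylinder_mono {f : E3 → ℝ → ℝ} (hf0 : ∀ x t, 0 ≤ f x t) {z₀ : E3 × ℝ} {ρ R : ℝ}
    (hρ : 0 < ρ) (hρR : ρ ≤ R)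
    (hf : ContinuousOn (fun z : E3 × ℝ => f z.1 z.2)
      (Metric.closedBall z₀.1 R ×ˢ Icc (z₀.2 - R ^ 2) z₀.2)) :
    ∫ t in Ioo (z₀.2 - ρ ^ 2) z₀.2, ∫ x in Metric.ball z₀.1 ρ, f x t
      ≤ ∫ t in Ioo (z₀.2 - R ^ 2) z₀.2, ∫ x in Metric.ball z₀.1 R, f x t := by
  have hsub : Icc (z₀.2 - ρ ^ 2) z₀.2 ⊆ Icc (z₀.2 - R ^ 2) z₀.2 :=
    Icc_subset_Icc_left (by gcongr)
  have hsub' : Ioo (z₀.2 - ρ ^ 2) z₀.2 ⊆ Ioo (z₀.2 - R ^ 2) z₀.2 :=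
    Ioo_subset_Ioo_left (by gcongr)
  have hR' := integrableOn_setIntegral_ball hf
  have hρ' := integrableOn_setIntegral_ball
    (hf.mono (prod_mono (Metric.closedBall_subset_closedBall hρR) hsub))
  have hinner : ∀ t ∈ Ioo (z₀.2 - ρ ^ 2) z₀.2,
      ∫ x in Metric.ball z₀.1 ρ, f x t ≤ ∫ x in Metric.ball z₀.1 R, f x t := fun t ht => by
    have hc : ContinuousOn (fun x => f x t) (Metric.closedBall z₀.1 R) :=
      hf.comp (Continuous.prodMk_left t).continuousOn
        fun x hx => ⟨hx, hsub (Ioo_subset_Icc_self ht)⟩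
    exact setIntegral_mono_set
      ((hc.integrableOn_compact (isCompact_closedBall _ _)).mono_set Metric.ball_subset_closedBall)
      (Filter.Eventually.of_forall fun x => hf0 x t)
      (Metric.ball_subset_ball hρR).eventuallyLE
  exact (setIntegral_mono_on hρ' (hR'.mono_set hsub') measurableSet_Ioo hinner).trans
    (setIntegral_mono_set hR'
      (Filter.Eventually.of_forall fun t => integral_nonneg fun x => hf0 x t) hsub'.eventuallyLE)

lemma DD_eq (P : E3 → ℝ → ℝ) (z₀ : E3 × ℝ) (R : ℝ) : DD P z₀ R = (R ^ 2)⁻¹ *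
    ∫ t in Ioo (z₀.2 - R ^ 2) z₀.2, ∫ x in Metric.ball z₀.1 R, √|P x t| ^ 3 := by
  simp only [DD, abs_rpow_three_halves]

/-- Interior pressure decay integrated over a cylinder. -/
lemma exists_cylinder_pressure_decay : ∃ C, 0 ≤ C ∧ ∀ (u : E3 → ℝ → E3) (P : E3 → ℝ → ℝ)
    (U : Set (E3 × ℝ)), IsNSQ1 u P U → ∀ z₀ : E3 × ℝ, z₀ ∈ Qyl (0, 0) (1 / 8) →
    ∀ ρ R : ℝ, 0 < ρ → 8 * ρ ≤ R → R ≤ 1 / 4 →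
      ∫ t in Ioo (z₀.2 - ρ ^ 2) z₀.2, ∫ x in Metric.ball z₀.1 ρ, √|P x t| ^ 3
        ≤ C * ((ρ / R) ^ 3
          * (∫ t in Ioo (z₀.2 - R ^ 2) z₀.2, ∫ x in Metric.ball z₀.1 R, √|P x t| ^ 3)
          + ∫ t in Ioo (z₀.2 - R ^ 2) z₀.2, ∫ x in Metric.ball z₀.1 R, ‖u x t‖ ^ 3) := by
  obtain ⟨C, hC, hloc⟩ := exists_local_pressure_decay
  refine ⟨C, hC, fun u P U h z₀ hz ρ R hρ hρR hR => ?_⟩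
  have hR0 : 0 < R := by linarith
  have hK := (closedBall_prod_Icc_subset_closure_Qyl hz hR0.le hR).trans h.subset_U
  have hPc : ContinuousOn (fun z : E3 × ℝ => √|P z.1 z.2| ^ 3)
      (Metric.closedBall z₀.1 R ×ˢ Icc (z₀.2 - R ^ 2) z₀.2) :=
    ((h.smooth_P.continuousOn.mono hK).abs.sqrt).pow 3
  have huc : ContinuousOn (fun z : E3 × ℝ => ‖u z.1 z.2‖ ^ 3)
      (Metric.closedBall z₀.1 R ×ˢ Icc (z₀.2 - R ^ 2) z₀.2) :=
    (h.smooth_u.continuousOn.mono hK).norm.pow 3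
  have hsub : Ioo (z₀.2 - ρ ^ 2) z₀.2 ⊆ Ioo (z₀.2 - R ^ 2) z₀.2 :=
    Ioo_subset_Ioo_left (by gcongr; linarith)
  have hIρ := integrableOn_setIntegral_ball (hPc.mono (prod_mono
    (Metric.closedBall_subset_closedBall (by linarith : ρ ≤ R))
    (Icc_subset_Icc_left (by gcongr; linarith : z₀.2 - R ^ 2 ≤ z₀.2 - ρ ^ 2))))
  have hIP := integrableOn_setIntegral_ball hPc
  have hIu := integrableOn_setIntegral_ball huc
  have hslice : ∀ t ∈ Ioo (z₀.2 - ρ ^ 2) z₀.2,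
      ∫ x in Metric.ball z₀.1 ρ, √|P x t| ^ 3
        ≤ C * ((ρ / R) ^ 3 * (∫ x in Metric.ball z₀.1 R, √|P x t| ^ 3)
          + ∫ x in Metric.ball z₀.1 R, ‖u x t‖ ^ 3) := fun t ht => by
    have hmaps : MapsTo (fun x : E3 => (x, t)) ((fun x : E3 => (x, t)) ⁻¹' U) U :=
      mapsTo_preimage _ _
    have hsm : ContDiff ℝ (⊤ : ℕ∞) (fun x : E3 => (x, t)) := contDiff_prodMk_left t
    exact hloc (fun x => P x t) (fun x => u x t) z₀.1 R ((fun x : E3 => (x, t)) ⁻¹' U) hR0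
      (h.open_U.preimage (Continuous.prodMk_left t))
      (fun x hx => hK ⟨hx, Ioo_subset_Icc_self (hsub ht)⟩)
      (h.smooth_P.comp hsm.contDiffOn hmaps) (h.smooth_u.comp hsm.contDiffOn hmaps)
      (fun x hx => h.lap_pressure hx) ρ hρ hρR
  have hI : IntegrableOn (fun t => C * ((ρ / R) ^ 3 * (∫ x in Metric.ball z₀.1 R, √|P x t| ^ 3)
      + ∫ x in Metric.ball z₀.1 R, ‖u x t‖ ^ 3)) (Ioo (z₀.2 - R ^ 2) z₀.2) :=
    ((hIP.const_mul _).add hIu).const_mul C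
  calc _ ≤ ∫ t in Ioo (z₀.2 - ρ ^ 2) z₀.2,
        C * ((ρ / R) ^ 3 * (∫ x in Metric.ball z₀.1 R, √|P x t| ^ 3)
          + ∫ x in Metric.ball z₀.1 R, ‖u x t‖ ^ 3) :=
        setIntegral_mono_on hIρ (hI.mono_set hsub) measurableSet_Ioo hslice
    _ ≤ ∫ t in Ioo (z₀.2 - R ^ 2) z₀.2,
        C * ((ρ / R) ^ 3 * (∫ x in Metric.ball z₀.1 R, √|P x t| ^ 3)
          + ∫ x in Metric.ball z₀.1 R, ‖u x t‖ ^ 3) :=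
        setIntegral_mono_set hI (Filter.Eventually.of_forall fun t =>
          mul_nonneg hC (by positivity)) hsub.eventuallyLE
    _ = _ := by rw [integral_const_mul, integral_add (hIP.const_mul _) hIu, integral_const_mul]

/-- pressure decay estimate. -/
theorem pressure_estimate :
    ∃ N : ℝ, ∀ (u : E3 → ℝ → E3) (P : E3 → ℝ → ℝ) (U : Set (E3 × ℝ)),
      IsNSQ1 u P U →
      ∀ z₀ : E3 × ℝ, z₀ ∈ Qyl (0, 0) (1/8) →
      ∀ ρ R : ℝ, 0 < ρ → 2 * ρ ≤ R → R ≤ 1/4 →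
        DD P z₀ ρ ≤ N * (ρ/R) * DD P z₀ R + N * (R/ρ) ^ 2 * CC u z₀ R := by
  obtain ⟨C, hC, hcyl⟩ := exists_cylinder_pressure_decay
  refine ⟨C + 512, fun u P U h z₀ hz ρ R hρ hρR hR => ?_⟩
  have hR0 : 0 < R := by linarith
  rw [DD_eq, DD_eq, CC]
  set I := ∫ t in Ioo (z₀.2 - R ^ 2) z₀.2, ∫ x in Metric.ball z₀.1 R, √|P x t| ^ 3 with hI
  set J := ∫ t in Ioo (z₀.2 - R ^ 2) z₀.2, ∫ x in Metric.ball z₀.1 R, ‖u x t‖ ^ 3 with hJ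
  have hI0 : 0 ≤ I := integral_nonneg fun t => by positivity
  have hJ0 : 0 ≤ J := integral_nonneg fun t => by positivity
  rw [inv_mul_le_iff₀ (by positivity)]
  have hrhs : ρ ^ 2 * ((C + 512) * (ρ / R) * ((R ^ 2)⁻¹ * I)
      + (C + 512) * (R / ρ) ^ 2 * ((R ^ 2)⁻¹ * J))
      = (C + 512) * ((ρ / R) ^ 3 * I + J) := by
    field_simp
  rw [hrhs]
  have hS0 : 0 ≤ (ρ / R) ^ 3 * I + J := by positivity
  rcases le_total (8 * ρ) R with h8 | h8
  · have := hcyl u P U h z₀ hz ρ R hρ h8 hR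
    linarith
  · have hK := (closedBall_prod_Icc_subset_closure_Qyl hz hR0.le hR).trans h.subset_U
    have h1 := integral_cylinder_mono (f := fun x t => √|P x t| ^ 3) (fun x t => by positivity)
      hρ (by linarith : ρ ≤ R) (((h.smooth_P.continuousOn.mono hK).abs.sqrt).pow 3)
    have h2 : 1 / 8 ≤ ρ / R := by rw [div_le_div_iff₀ (by norm_num) hR0]; linarith
    have h3 : (1 / 8 : ℝ) ^ 3 ≤ (ρ / R) ^ 3 := by gcongr
    have h4 := mul_le_mul_of_nonneg_right h3 hI0
    have h5 := mul_nonneg hC hS0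
    linarith
end
end

section
/- Let 1≤p<∞. Let λ:[0,1)→[0,1] be nonincreasing and set Λ(x)=λ(|x|) for x in the unit ball B(1)⊂ℝ³. Then for every continuously differentiable function g on the closed unit ball and every y∈B(1), ∫_{B(1)} |g(x)−g(y)|^p · Λ(x)Λ(y) dx ≤ (2^{p+2}/(p+2)) · ∫_{B(1)} |∇g(z)|^p · |z−y|^{−2} · Λ(z) dz. -/
open Real MeasureTheory Set
noncomputable section

theorem abs_sub_rpow_le_integral_fderiv {E : Type*} [NormedAddCommGroup E] [NormedSpace ℝ E]
    {p : ℝ} (hp : 1 ≤ p) {s : Set E} (hs : IsOpen s) (hc : Convex ℝ s) {g : E → ℝ}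
    (hg : ContDiffOn ℝ 1 g s) {x y : E} (hx : x ∈ s) (hy : y ∈ s) :
    IntegrableOn (fun t : ℝ => ‖fderiv ℝ g (y + t • (x - y))‖ ^ p) (Ioc 0 1) ∧
    |g x - g y| ^ p ≤
      ‖x - y‖ ^ p * ∫ t in Ioc (0:ℝ) 1, ‖fderiv ℝ g (y + t • (x - y))‖ ^ p := by
  have hp0 : 0 ≤ p := by linarith
  have hmem : ∀ t ∈ Icc (0:ℝ) 1, y + t • (x - y) ∈ s := fun t ht =>
    hc.add_smul_sub_mem hy hx ht
  have hcont : ContinuousOn (fun t : ℝ => fderiv ℝ g (y + t • (x - y))) (Icc 0 1) :=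
    (hg.continuousOn_fderiv_of_isOpen hs le_rfl).comp (by fun_prop) hmem
  have hintp : IntegrableOn (fun t : ℝ => ‖fderiv ℝ g (y + t • (x - y))‖ ^ p) (Ioc 0 1) :=
    ((hcont.norm.rpow_const fun _ _ => Or.inr hp0).integrableOn_Icc).mono_set Ioc_subset_Icc_self
  have hint : IntegrableOn (fun t : ℝ => ‖fderiv ℝ g (y + t • (x - y))‖) (Ioc 0 1) :=
    hcont.norm.integrableOn_Icc.mono_set Ioc_subset_Icc_self
  refine ⟨hintp, ?_⟩
  have hderiv : ∀ t ∈ uIcc (0:ℝ) 1, HasDerivAt (fun t : ℝ => g (y + t • (x - y)))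
      (fderiv ℝ g (y + t • (x - y)) (x - y)) t := by
    intro t ht
    rw [uIcc_of_le zero_le_one] at ht
    have h1 : HasFDerivAt g (fderiv ℝ g (y + t • (x - y))) (y + t • (x - y)) :=
      ((hg.differentiableOn one_ne_zero).differentiableAt
        (hs.mem_nhds (hmem t ht))).hasFDerivAt
    have h2 : HasDerivAt (fun t : ℝ => y + t • (x - y)) (x - y) t := by
      simpa using ((hasDerivAt_id t).smul_const (x - y)).const_add y
    exact h1.comp_hasDerivAt t h2
  have hftc := intervalIntegral.integral_eq_sub_of_hasDerivAt hderiv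
    ((hcont.clm_apply continuousOn_const).intervalIntegrable_of_Icc zero_le_one)
  rw [intervalIntegral.integral_of_le zero_le_one] at hftc
  simp only [one_smul, zero_smul, add_zero, add_sub_cancel] at hftc
  have hle : |g x - g y| ≤
      ‖x - y‖ * ∫ t in Ioc (0:ℝ) 1, ‖fderiv ℝ g (y + t • (x - y))‖ := by
    rw [← hftc, ← Real.norm_eq_abs, ← integral_const_mul]
    refine norm_integral_le_of_norm_le (hint.const_mul _) (ae_of_all _ fun t => ?_)
    rw [mul_comm]
    exact ContinuousLinearMap.le_opNorm _ _
  have : IsProbabilityMeasure (volume.restrict (Ioc (0:ℝ) 1)) := ⟨by simp⟩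
  have hjensen := (convexOn_rpow hp).map_integral_le (μ := volume.restrict (Ioc (0:ℝ) 1))
    (f := fun t : ℝ => ‖fderiv ℝ g (y + t • (x - y))‖)
    (continuousOn_id.rpow_const fun _ _ => Or.inr hp0) isClosed_Ici
    (ae_of_all _ fun t => norm_nonneg _) hint hintp
  calc |g x - g y| ^ p
      ≤ (‖x - y‖ * ∫ t in Ioc (0:ℝ) 1, ‖fderiv ℝ g (y + t • (x - y))‖) ^ p :=
        rpow_le_rpow (abs_nonneg _) hle hp0
    _ = ‖x - y‖ ^ p * (∫ t in Ioc (0:ℝ) 1, ‖fderiv ℝ g (y + t • (x - y))‖) ^ p :=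
        mul_rpow (norm_nonneg _) (integral_nonneg fun _ => norm_nonneg _)
    _ ≤ _ := by gcongr

theorem mul_le_of_mem_segment_of_antitoneOn {E : Type*} [NormedAddCommGroup E] [NormedSpace ℝ E]
    {lam : ℝ → ℝ} (hmono : AntitoneOn lam (Ico 0 1))
    (hrange : ∀ s ∈ Ico (0:ℝ) 1, lam s ∈ Icc (0:ℝ) 1) {x y z : E}
    (hx : ‖x‖ < 1) (hy : ‖y‖ < 1) (hz : z ∈ segment ℝ x y) :
    lam ‖x‖ * lam ‖y‖ ≤ lam ‖z‖ := by
  have hx' : ‖x‖ ∈ Ico (0:ℝ) 1 := ⟨norm_nonneg _, hx⟩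
  have hy' : ‖y‖ ∈ Ico (0:ℝ) 1 := ⟨norm_nonneg _, hy⟩
  have hmax : ‖z‖ ≤ max ‖x‖ ‖y‖ := (convexOn_univ_norm (E := E)).le_on_segment trivial trivial hz
  have hz' : ‖z‖ ∈ Ico (0:ℝ) 1 := ⟨norm_nonneg _, hmax.trans_lt (max_lt hx hy)⟩
  obtain ⟨hx0, hx1⟩ := hrange _ hx'
  obtain ⟨hy0, hy1⟩ := hrange _ hy'
  rcases le_max_iff.1 hmax with h | h
  · exact (mul_le_of_le_one_right hx0 hy1).trans (hmono hz' hx' h)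
  · exact (mul_le_of_le_one_left hy0 hx1).trans (hmono hz' hy' h)

theorem lintegral_comp_homothety {E : Type*} [NormedAddCommGroup E] [NormedSpace ℝ E]
    [FiniteDimensional ℝ E] [MeasurableSpace E] [BorelSpace E] (μ : Measure E)
    [μ.IsAddHaarMeasure] {f : E → ENNReal} (hf : Measurable f) (y : E) {t : ℝ} (ht : 0 < t) :
    ∫⁻ x, f (y + t • (x - y)) ∂μ =
      ENNReal.ofReal (t ^ Module.finrank ℝ E)⁻¹ * ∫⁻ z, f z ∂μ := by
  rw [lintegral_sub_right_eq_self (fun x => f (y + t • x)) y,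
    ← lintegral_map (f := fun x => f (y + x)) (by fun_prop) (measurable_const_smul t),
    Measure.map_addHaar_smul μ ht.ne', lintegral_smul_measure, lintegral_add_left_eq_self,
    abs_of_pos (by positivity), smul_eq_mul]

theorem lintegral_Ioi_rpow_of_lt {a c : ℝ} (ha : a < -1) (hc : 0 < c) :
    ∫⁻ t in Ioi c, ENNReal.ofReal (t ^ a) = ENNReal.ofReal (-c ^ (a + 1) / (a + 1)) := by
  rw [← integral_Ioi_rpow_of_lt ha hc, ofReal_integral_eq_lintegral_ofReal
    (integrableOn_Ioi_rpow_of_lt ha hc)]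
  filter_upwards [ae_restrict_mem measurableSet_Ioi] with t ht
  exact rpow_nonneg (hc.trans ht).le _

theorem lintegral_radial_kernel_le {p r : ℝ} (hp : 0 ≤ p) (hr : 0 < r) :
    ∫⁻ t in Ioc (0:ℝ) 1, ENNReal.ofReal (t ^ 3)⁻¹ *
        (if r < 2 * t then ENNReal.ofReal ((r / t) ^ p) else 0)
      ≤ ENNReal.ofReal (2 ^ (p + 2) / (p + 2) * r ^ (-2 : ℝ)) := by
  have hr2 : 0 < r / 2 := by positivity
  calc _ ≤ ∫⁻ t, (Ioi (r / 2)).indicator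
          (fun t => ENNReal.ofReal (r ^ p) * ENNReal.ofReal (t ^ (-3 - p))) t := by
        rw [← lintegral_indicator measurableSet_Ioc]
        refine lintegral_mono fun t => ?_
        refine indicator_le (fun t ht => ?_) t
        split_ifs with h
        · rw [indicator_of_mem (show t ∈ Ioi (r / 2) by simp only [mem_Ioi]; linarith),
            ← ENNReal.ofReal_mul (by have := ht.1; positivity),
            ← ENNReal.ofReal_mul (by positivity), div_rpow hr.le ht.1.le,
            sub_eq_add_neg, rpow_add ht.1, rpow_neg ht.1.le, rpow_neg ht.1.le]
          refine (congrArg ENNReal.ofReal ?_).le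
          norm_cast
          ring
        · simp
    _ = ENNReal.ofReal (r ^ p) * ENNReal.ofReal (-(r / 2) ^ (-3 - p + 1) / (-3 - p + 1)) := by
        rw [lintegral_indicator measurableSet_Ioi, lintegral_const_mul _ (by fun_prop),
          lintegral_Ioi_rpow_of_lt (by linarith) hr2]
    _ = _ := by
        rw [← ENNReal.ofReal_mul (by positivity)]
        congr 1
        have h2 : -3 - p + 1 = -(p + 2) := by ring
        have h3 : r ^ p * r ^ (-(p + 2)) = r ^ (-2 : ℝ) := by
          rw [← rpow_add hr]; congr 1; ring
        rw [h2, div_rpow hr.le zero_le_two, rpow_neg zero_le_two (p + 2), neg_div_neg_eq, ← h3]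
        field_simp

theorem lintegral_ball_segment_le {p : ℝ} (hp : 0 ≤ p) {f : E3 → ENNReal} (hf : Measurable f)
    {y : E3} (hy : y ∈ Metric.ball (0:E3) 1) :
    ∫⁻ x in Metric.ball (0:E3) 1, ∫⁻ t in Ioc (0:ℝ) 1,
        ENNReal.ofReal (‖x - y‖ ^ p) * f (y + t • (x - y))
      ≤ ∫⁻ z, ENNReal.ofReal (2 ^ (p + 2) / (p + 2) * ‖z - y‖ ^ (-2 : ℝ)) * f z := by
  set k : ℝ → E3 → ENNReal := fun t z =>
    (if ‖z - y‖ < 2 * t then ENNReal.ofReal ((‖z - y‖ / t) ^ p) else 0) with hk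
  have hkm : Measurable fun q : ℝ × E3 => k q.1 q.2 := by
    refine Measurable.ite (measurableSet_lt (by fun_prop) (by fun_prop)) ?_ measurable_const
    fun_prop
  calc _ ≤ ∫⁻ x in Metric.ball (0:E3) 1, ∫⁻ t in Ioc (0:ℝ) 1,
          k t (y + t • (x - y)) * f (y + t • (x - y)) := by
        refine setLIntegral_mono' measurableSet_ball fun x hx =>
          setLIntegral_mono' measurableSet_Ioc fun t ht => ?_
        have hxy : ‖x - y‖ < 2 := by
          have := norm_sub_le x y
          rw [mem_ball_zero_iff] at hx hy
          linarith
        have hn : ‖y + t • (x - y) - y‖ = t * ‖x - y‖ := by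
          rw [add_sub_cancel_left, norm_smul, norm_of_nonneg ht.1.le]
        simp only [hk, hn]
        rw [if_pos (by nlinarith [ht.1]), mul_div_cancel_left₀ _ ht.1.ne']
    _ ≤ ∫⁻ x, ∫⁻ t in Ioc (0:ℝ) 1, k t (y + t • (x - y)) * f (y + t • (x - y)) :=
        setLIntegral_le_lintegral _ _
    _ = ∫⁻ t in Ioc (0:ℝ) 1, ∫⁻ x, k t (y + t • (x - y)) * f (y + t • (x - y)) := by
        refine lintegral_lintegral_swap (Measurable.aemeasurable ?_)
        refine Measurable.mul ?_ (hf.comp (by fun_prop))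
        exact hkm.comp (f := fun q : E3 × ℝ => (q.2, y + q.2 • (q.1 - y))) (by fun_prop)
    _ = ∫⁻ t in Ioc (0:ℝ) 1, ∫⁻ z, ENNReal.ofReal (t ^ 3)⁻¹ * k t z * f z := by
        refine setLIntegral_congr_fun measurableSet_Ioc fun t ht => ?_
        have hkt : Measurable (k t) := hkm.comp (f := fun z => (t, z)) (by fun_prop)
        have := lintegral_comp_homothety volume (hkt.mul hf) y ht.1
        simp only [Pi.mul_apply, finrank_euclideanSpace_fin] at this
        simp only [this, mul_assoc]
        exact (lintegral_const_mul _ (hkt.mul hf)).symm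
    _ = ∫⁻ z, (∫⁻ t in Ioc (0:ℝ) 1, ENNReal.ofReal (t ^ 3)⁻¹ * k t z) * f z := by
        rw [lintegral_lintegral_swap]
        · refine lintegral_congr fun z => lintegral_mul_const _ ?_
          have : Measurable fun t => k t z := hkm.comp (f := fun t => (t, z)) (by fun_prop)
          fun_prop
        · refine Measurable.aemeasurable ?_
          exact (Measurable.mul (by fun_prop) hkm).mul (by fun_prop)
    _ ≤ _ := by
        refine lintegral_mono_ae ?_
        filter_upwards [compl_mem_ae_iff.2 (measure_singleton y)] with z hz
        gcongr
        exact lintegral_radial_kernel_le hp (norm_pos_iff.2 (sub_ne_zero.2 hz))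

theorem integrableOn_ball_norm_sub_rpow (y : E3) (r : ℝ) :
    IntegrableOn (fun z => ‖z - y‖ ^ (-2 : ℝ)) (Metric.ball y r) := by
  have h : IntegrableOn (fun z : E3 => ‖z‖ ^ (-2 : ℝ)) (Metric.ball 0 r) := by
    rw [integrableOn_fun_norm_addHaar volume (f := fun s : ℝ => s ^ (-2 : ℝ)),
      integrableOn_congr_fun (g := fun _ => (1:ℝ)) _ measurableSet_Ioo]
    · exact integrableOn_const (by simp)
    · intro s hs
      have := hs.1.ne'
      simp only [finrank_euclideanSpace_fin, smul_eq_mul, rpow_neg hs.1.le]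
      norm_cast
      field_simp
  rw [← integrable_indicator_iff measurableSet_ball] at h ⊢
  convert! h.comp_sub_right y using 1
  ext z
  simp [indicator, dist_eq_norm]

theorem AntitoneOn.exists_measurable_eqOn_Ico {f : ℝ → ℝ} (hf : AntitoneOn f (Ico 0 1))
    (hrange : ∀ s ∈ Ico (0:ℝ) 1, f s ∈ Icc (0:ℝ) 1) :
    ∃ m : ℝ → ℝ, Measurable m ∧ EqOn m f (Ico 0 1) := by
  refine ⟨fun s => if s < 0 then 1 else if s < 1 then f s else 0, Antitone.measurable ?_, ?_⟩
  · intro a b hab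
    dsimp only
    split_ifs with h1 h2 h3 h4 h5 h6 h7 h8
    all_goals first
      | exact le_rfl
      | exact zero_le_one
      | (exfalso; linarith)
      | exact (hrange _ ⟨not_lt.1 ‹_›, ‹_›⟩).2
      | exact (hrange _ ⟨not_lt.1 ‹_›, ‹_›⟩).1
      | exact hf ⟨not_lt.1 ‹_›, ‹_›⟩ ⟨not_lt.1 ‹_›, ‹_›⟩ hab
  · intro s hs
    simp [hs.1.not_gt, hs.2]

/-- pointwise weighted difference estimate on the unit ball of `ℝ³`. -/
theorem weighted_difference_estimate (p : ℝ) (hp : 1 ≤ p)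
    (lam : ℝ → ℝ)
    (hmono : ∀ s₁ ∈ Ico (0:ℝ) 1, ∀ s₂ ∈ Ico (0:ℝ) 1, s₁ ≤ s₂ → lam s₂ ≤ lam s₁)
    (hrange : ∀ s ∈ Ico (0:ℝ) 1, lam s ∈ Icc (0:ℝ) 1)
    (g : E3 → ℝ) (hg : ContDiffOn ℝ 1 g (Metric.closedBall (0:E3) 1))
    (y : E3) (hy : y ∈ Metric.ball (0:E3) 1) :
    (∫ x in Metric.ball (0:E3) 1, |g x - g y| ^ p * (lam ‖x‖ * lam ‖y‖))
      ≤ (2 ^ (p + 2) / (p + 2)) *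
        ∫ z in Metric.ball (0:E3) 1,
          ‖fderivWithin ℝ g (Metric.closedBall (0:E3) 1) z‖ ^ p
            * ‖z - y‖ ^ (-2 : ℝ) * lam ‖z‖ := by
  have hp0 : 0 ≤ p := by linarith
  have hanti : AntitoneOn lam (Ico 0 1) := fun a ha b hb hab => hmono a ha b hb hab
  have hIco : ∀ z ∈ Metric.ball (0:E3) 1, ‖z‖ ∈ Ico (0:ℝ) 1 := fun z hz =>
    ⟨norm_nonneg _, mem_ball_zero_iff.1 hz⟩
  obtain ⟨m, hm, hml⟩ := hanti.exists_measurable_eqOn_Ico hrange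
  have hD : ∀ z ∈ Metric.ball (0:E3) 1,
      fderivWithin ℝ g (Metric.closedBall (0:E3) 1) z = fderiv ℝ g z := fun z hz =>
    fderivWithin_of_mem_nhds (Filter.mem_of_superset (Metric.isOpen_ball.mem_nhds hz)
      Metric.ball_subset_closedBall)
  have hDm : Measurable fun z => ‖fderiv ℝ g z‖ := (measurable_fderiv ℝ g).norm
  have hnonneg : ∀ z ∈ Metric.ball (0:E3) 1, 0 ≤
      ‖fderiv ℝ g z‖ ^ p * ‖z - y‖ ^ (-2 : ℝ) * m ‖z‖ := fun z hz => by
    rw [hml (hIco z hz)]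
    have := (hrange _ (hIco z hz)).1
    positivity
  have hR : ∫ z in Metric.ball (0:E3) 1,
          ‖fderivWithin ℝ g (Metric.closedBall (0:E3) 1) z‖ ^ p
            * ‖z - y‖ ^ (-2 : ℝ) * lam ‖z‖ =
      ∫ z in Metric.ball (0:E3) 1, ‖fderiv ℝ g z‖ ^ p * ‖z - y‖ ^ (-2 : ℝ) * m ‖z‖ := by
    refine setIntegral_congr_fun measurableSet_ball fun z hz => ?_
    simp only [hD z hz, hml (hIco z hz)]
  rw [hR]
  have hRnn : 0 ≤ ∫ z in Metric.ball (0:E3) 1,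
      ‖fderiv ℝ g z‖ ^ p * ‖z - y‖ ^ (-2 : ℝ) * m ‖z‖ :=
    setIntegral_nonneg measurableSet_ball hnonneg
  obtain ⟨C, hC⟩ : ∃ C, ∀ z ∈ Metric.ball (0:E3) 1, ‖fderiv ℝ g z‖ ≤ C := by
    have hu : UniqueDiffOn ℝ (Metric.closedBall (0:E3) 1) :=
      uniqueDiffOn_convex (convex_closedBall _ _)
        ⟨0, mem_interior_iff_mem_nhds.2 (Metric.closedBall_mem_nhds _ one_pos)⟩
    obtain ⟨C, hC⟩ := (isCompact_closedBall (0:E3) 1).exists_bound_of_continuousOn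
      (hg.continuousOn_fderivWithin hu le_rfl)
    exact ⟨C, fun z hz => hD z hz ▸ hC z (Metric.ball_subset_closedBall hz)⟩
  have hRint : IntegrableOn
      (fun z => ‖fderiv ℝ g z‖ ^ p * ‖z - y‖ ^ (-2 : ℝ) * m ‖z‖) (Metric.ball (0:E3) 1) := by
    have hsub : Metric.ball (0:E3) 1 ⊆ Metric.ball y 2 := Metric.ball_subset_ball' (by
      rw [mem_ball_zero_iff] at hy
      rw [dist_zero_left]
      linarith)
    refine Integrable.mono' (((integrableOn_ball_norm_sub_rpow y 2).mono_set hsub).const_mul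
      (C ^ p)) (Measurable.aestronglyMeasurable (by fun_prop)) ?_
    filter_upwards [ae_restrict_mem measurableSet_ball] with z hz
    rw [norm_of_nonneg (hnonneg z hz), hml (hIco z hz)]
    have h1 := hrange _ (hIco z hz)
    have h2 := hC z hz
    refine (mul_le_of_le_one_right (by positivity) h1.2).trans ?_
    gcongr
  by_cases hL : IntegrableOn (fun x => |g x - g y| ^ p * (lam ‖x‖ * lam ‖y‖))
      (Metric.ball (0:E3) 1)
  swap
  · rw [integral_undef hL]
    positivity
  have hgb : ContDiffOn ℝ 1 g (Metric.ball (0:E3) 1) := hg.mono Metric.ball_subset_closedBall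
  have hlamy := (hrange _ (hIco y hy)).1
  set f : E3 → ENNReal := (Metric.ball (0:E3) 1).indicator
    fun z => ENNReal.ofReal (‖fderiv ℝ g z‖ ^ p * m ‖z‖) with hf
  have hfm : Measurable f := Measurable.indicator (by fun_prop) measurableSet_ball
  rw [← ENNReal.ofReal_le_ofReal_iff (by positivity), ENNReal.ofReal_mul (by positivity),
    ofReal_integral_eq_lintegral_ofReal hL, ofReal_integral_eq_lintegral_ofReal hRint
      ((ae_restrict_mem measurableSet_ball).mono hnonneg),
    ← lintegral_const_mul' _ _ ENNReal.ofReal_ne_top]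
  · calc _ ≤ ∫⁻ x in Metric.ball (0:E3) 1, ∫⁻ t in Ioc (0:ℝ) 1,
          ENNReal.ofReal (‖x - y‖ ^ p) * f (y + t • (x - y)) := by
          refine setLIntegral_mono' measurableSet_ball fun x hx => ?_
          obtain ⟨hint, hle⟩ :=
            abs_sub_rpow_le_integral_fderiv hp Metric.isOpen_ball (convex_ball 0 1) hgb hx hy
          have hlamx := (hrange _ (hIco x hx)).1
          set w := lam ‖x‖ * lam ‖y‖
          have hw0 : 0 ≤ w := mul_nonneg hlamx hlamy
          calc ENNReal.ofReal (|g x - g y| ^ p * w)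
              ≤ ENNReal.ofReal (∫ t in Ioc (0:ℝ) 1,
                  ‖x - y‖ ^ p * (‖fderiv ℝ g (y + t • (x - y))‖ ^ p * w)) := by
                rw [integral_const_mul, integral_mul_const, ← mul_assoc (‖x - y‖ ^ p)]
                exact ENNReal.ofReal_le_ofReal (mul_le_mul_of_nonneg_right hle hw0)
            _ = ∫⁻ t in Ioc (0:ℝ) 1, ENNReal.ofReal
                  (‖x - y‖ ^ p * (‖fderiv ℝ g (y + t • (x - y))‖ ^ p * w)) :=
                ofReal_integral_eq_lintegral_ofReal ((hint.mul_const w).const_mul _)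
                  (ae_of_all _ fun t => by positivity)
            _ ≤ _ := by
                refine setLIntegral_mono' measurableSet_Ioc fun t ht => ?_
                have hz : y + t • (x - y) ∈ Metric.ball (0:E3) 1 :=
                  (convex_ball 0 1).add_smul_sub_mem hy hx (Ioc_subset_Icc_self ht)
                have hseg : y + t • (x - y) ∈ segment ℝ x y := by
                  rw [segment_symm, segment_eq_image']
                  exact ⟨t, Ioc_subset_Icc_self ht, rfl⟩
                rw [ENNReal.ofReal_mul (by positivity), hf, indicator_of_mem hz, hml (hIco _ hz)]
                gcongr
                exact mul_le_of_mem_segment_of_antitoneOn hanti hrange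
                  (hIco x hx).2 (hIco y hy).2 hseg
      _ ≤ ∫⁻ z, ENNReal.ofReal (2 ^ (p + 2) / (p + 2) * ‖z - y‖ ^ (-2 : ℝ)) * f z :=
          lintegral_ball_segment_le hp0 hfm hy
      _ = _ := by
          rw [← lintegral_indicator measurableSet_ball]
          refine lintegral_congr fun z => ?_
          by_cases hz : z ∈ Metric.ball (0:E3) 1
          · rw [hf, indicator_of_mem hz, indicator_of_mem hz, ← ENNReal.ofReal_mul (by positivity),
              ← ENNReal.ofReal_mul (by positivity)]
            congr 1
            ring
          · simp only [hf, indicator_of_notMem hz, mul_zero]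
  · filter_upwards [ae_restrict_mem measurableSet_ball] with x hx
    have hlamx := (hrange _ (hIco x hx)).1
    exact mul_nonneg (by positivity) (mul_nonneg hlamx hlamy)
end
end
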